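/- Let k be an algebraically closed field of characteristic p > 0, G̃ a finite group, G a normal subgroup of G̃, B = kG·b a block of kG, and I := I_{G̃}(B) the inertia group of B in G̃. Assume: (i) every left finite brick in B-mod is I-stable; (ii) H²(I/G, k^×) is trivial; (iii) the group algebra k[I/G] is basic. Let e be the number of isomorphism classes of simple k[I/G]-modules. Then for every left finite semibrick S in B-mod and every indecomposable direct summand S_i of S, there exist exactly e isomorphism classes of kI-modules extending S_i, and each of these extending modules is a brick in kI-mod. -/

import Mathlib

open scoped TensorProduct

namespace Paper

/-! ### Torsion-theoretic notions over an arbitrary ring -/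

section Torsion

variable (R : Type) [Ring R]

/-- `FacCl R C` : quotient modules of finite direct sums of modules in `C`. -/
def FacCl (C : ModuleCat.{0} R → Prop) (M : ModuleCat.{0} R) : Prop :=
  ∃ (n : ℕ) (N : Fin n → ModuleCat.{0} R), (∀ i, C (N i)) ∧
    ∃ f : ((i : Fin n) → N i) →ₗ[R] M, Function.Surjective f

/-- `SubCl R C` : submodules of finite direct sums of modules in `C`. -/
def SubCl (C : ModuleCat.{0} R → Prop) (M : ModuleCat.{0} R) : Prop :=
  ∃ (n : ℕ) (N : Fin n → ModuleCat.{0} R), (∀ i, C (N i)) ∧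
    ∃ f : M →ₗ[R] ((i : Fin n) → N i), Function.Injective f

/-- `AddCl R C` : direct summands of finite direct sums of modules in `C`. -/
def AddCl (C : ModuleCat.{0} R → Prop) (M : ModuleCat.{0} R) : Prop :=
  ∃ (n : ℕ) (N : Fin n → ModuleCat.{0} R), (∀ i, C (N i)) ∧
    ∃ (s : M →ₗ[R] ((i : Fin n) → N i)) (r : ((i : Fin n) → N i) →ₗ[R] M),
      ∀ m : M, r (s m) = m

/-- `FiltCl R C` : modules having a finite filtration with subquotients in `add C`. -/
def FiltCl (C : ModuleCat.{0} R → Prop) (M : ModuleCat.{0} R) : Prop :=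
  ∃ (l : ℕ) (F : Fin (l + 1) → Submodule R M),
    Monotone F ∧ F 0 = ⊥ ∧ F (Fin.last l) = ⊤ ∧
      ∀ i : Fin l, AddCl R C (ModuleCat.of R
        (↥(F i.succ) ⧸ Submodule.comap (F i.succ).subtype (F i.castSucc)))

/-- A torsion class inside the ambient class `Amb` of modules:  a subclass of `Amb`
closed under quotient modules, finite direct sums and extensions. -/
def IsTorsionClassIn (Amb T : ModuleCat.{0} R → Prop) : Prop :=
  (∀ M, T M → Amb M) ∧
  (∀ (M N : ModuleCat.{0} R) (f : M →ₗ[R] N),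
      Amb N → Function.Surjective f → T M → T N) ∧
  (∀ (n : ℕ) (N : Fin n → ModuleCat.{0} R), (∀ i, T (N i)) →
      Amb (ModuleCat.of R ((i : Fin n) → N i)) →
      T (ModuleCat.of R ((i : Fin n) → N i))) ∧
  (∀ (M : ModuleCat.{0} R) (A : Submodule R M), Amb M →
      T (ModuleCat.of R ↥A) → T (ModuleCat.of R (↥M ⧸ A)) → T M)

/-- A torsion-free class inside the ambient class `Amb` of modules. -/
def IsTorsionFreeClassIn (Amb F : ModuleCat.{0} R → Prop) : Prop :=
  (∀ M, F M → Amb M) ∧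
  (∀ (M N : ModuleCat.{0} R) (f : M →ₗ[R] N),
      Amb M → Function.Injective f → F N → F M) ∧
  (∀ (n : ℕ) (N : Fin n → ModuleCat.{0} R), (∀ i, F (N i)) →
      Amb (ModuleCat.of R ((i : Fin n) → N i)) →
      F (ModuleCat.of R ((i : Fin n) → N i))) ∧
  (∀ (M : ModuleCat.{0} R) (A : Submodule R M), Amb M →
      F (ModuleCat.of R ↥A) → F (ModuleCat.of R (↥M ⧸ A)) → F M)

/-- The smallest torsion class (inside `Amb`) containing the class `C`. -/
def TorsClIn (Amb C : ModuleCat.{0} R → Prop) (M : ModuleCat.{0} R) : Prop :=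
  ∀ T : ModuleCat.{0} R → Prop, IsTorsionClassIn R Amb T →
    (∀ X, Amb X → C X → T X) → T M

/-- The smallest torsion-free class (inside `Amb`) containing the class `C`. -/
def TorfClIn (Amb C : ModuleCat.{0} R → Prop) (M : ModuleCat.{0} R) : Prop :=
  ∀ F : ModuleCat.{0} R → Prop, IsTorsionFreeClassIn R Amb F →
    (∀ X, Amb X → C X → F X) → F M

/-- The ambient class of finitely generated modules. -/
def FGMod (M : ModuleCat.{0} R) : Prop := Module.Finite R M

def ContravariantlyFinite (Amb C : ModuleCat.{0} R → Prop) : Prop :=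
  ∀ M : ModuleCat.{0} R, Amb M →
    ∃ X : ModuleCat.{0} R, C X ∧ ∃ f : X →ₗ[R] M,
      ∀ Y : ModuleCat.{0} R, C Y → ∀ g : Y →ₗ[R] M,
        ∃ h : Y →ₗ[R] X, ∀ y : Y, f (h y) = g y

def CovariantlyFinite (Amb C : ModuleCat.{0} R → Prop) : Prop :=
  ∀ M : ModuleCat.{0} R, Amb M →
    ∃ X : ModuleCat.{0} R, C X ∧ ∃ f : M →ₗ[R] X,
      ∀ Y : ModuleCat.{0} R, C Y → ∀ g : M →ₗ[R] Y,
        ∃ h : X →ₗ[R] Y, ∀ m : M, h (f m) = g m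

def FunctoriallyFinite (Amb C : ModuleCat.{0} R → Prop) : Prop :=
  ContravariantlyFinite R Amb C ∧ CovariantlyFinite R Amb C

/-- `M` is (isomorphic to) a direct summand of `W`. -/
def IsSummandOf (X W : Type) [AddCommGroup X] [Module R X]
    [AddCommGroup W] [Module R W] : Prop :=
  ∃ (s : X →ₗ[R] W) (r : W →ₗ[R] X), ∀ x : X, r (s x) = x

/-- An indecomposable module: nonzero and not the direct sum of two nonzero submodules. -/
def IndecMod (M : Type) [AddCommGroup M] [Module R M] : Prop :=
  Nontrivial M ∧ ∀ A B : Submodule R M, IsCompl A B → A = ⊥ ∨ B = ⊥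

/-- A projective cover: a surjection from a projective module with superfluous kernel. -/
def IsProjCover {P V : Type} [AddCommGroup P] [Module R P]
    [AddCommGroup V] [Module R V] (π : P →ₗ[R] V) : Prop :=
  Module.Projective R P ∧ Function.Surjective π ∧
    ∀ L : Submodule R P, LinearMap.ker π ⊔ L = ⊤ → L = ⊤

/-- An injective envelope: an injection into an injective module with essential image. -/
def IsInjEnv {V I : Type} [AddCommGroup V] [Module R V]
    [AddCommGroup I] [Module R I] (ι : V →ₗ[R] I) : Prop :=
  Module.Injective R I ∧ Function.Injective ι ∧
    ∀ L : Submodule R I, L ≠ ⊥ → L ⊓ LinearMap.range ι ≠ ⊥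

/-- A central idempotent. -/
def IsCentralIdem (b : R) : Prop :=
  b * b = b ∧ ∀ a : R, a * b = b * a

/-- A block idempotent: a primitive idempotent of the center. -/
def IsBlockIdem (b : R) : Prop :=
  b ≠ 0 ∧ IsCentralIdem R b ∧
    ∀ c d : R, IsCentralIdem R c → IsCentralIdem R d →
      c * d = 0 → d * c = 0 → b = c + d → c = 0 ∨ d = 0

/-- The module `U` lies in the block determined by the central idempotent `b`. -/
def LiesIn (b : R) (U : Type) [AddCommGroup U] [Module R U] : Prop :=
  ∀ u : U, b • u = u

/-- The `b`-component `b·M` of a module `M`, for a central idempotent `b`. -/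
def blockComp (b : R) (hb : ∀ a : R, a * b = b * a)
    (M : Type) [AddCommGroup M] [Module R M] : Submodule R M where
  carrier := {m : M | b • m = m}
  add_mem' := by
    intro x y hx hy
    simp only [Set.mem_setOf_eq] at *
    rw [smul_add, hx, hy]
  zero_mem' := by simp
  smul_mem' := by
    intro c m hm
    simp only [Set.mem_setOf_eq] at *
    rw [smul_smul, ← hb c, mul_smul, hm]

/-- The ambient class of finitely generated modules lying in the block of `b`. -/
def BlockFG (b : R) : ModuleCat.{0} R → Prop :=
  fun M => Module.Finite R M ∧ LiesIn R b M

end Torsion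

/-! ### Bundled modules with a compatible `k`-structure -/

structure BModule (k R : Type) [CommSemiring k] [Ring R] [Algebra k R] : Type 1 where
  carrier : Type
  [isAddCommGroup : AddCommGroup carrier]
  [isModuleK : Module k carrier]
  [isModuleR : Module R carrier]
  [isTower : IsScalarTower k R carrier]

attribute [instance] BModule.isAddCommGroup BModule.isModuleK BModule.isModuleR
  BModule.isTower

instance (k R : Type) [CommSemiring k] [Ring R] [Algebra k R] :
    CoeSort (BModule k R) Type :=
  ⟨BModule.carrier⟩

section GroupAlg

variable (k : Type) [Field k]

/-- A brick over a `k`-algebra `R`: a nonzero module all of whose `R`-endomorphisms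
are given by scalars in `k`. -/
def IsBrickOver (R : Type) [Ring R] [Algebra k R]
    (U : Type) [AddCommGroup U] [Module R U] : Prop :=
  Nontrivial U ∧ ∀ f : U →ₗ[R] U, ∃ c : k, ∀ u : U, f u = algebraMap k R c • u

/-- A module which is a finite direct sum of bricks with no nonzero homomorphisms
between non-isomorphic summands. -/
def IsSemibrickModule (R : Type) [Ring R] [Algebra k R]
    (M : Type) [AddCommGroup M] [Module R M] : Prop :=
  ∃ (m : ℕ) (T : Fin m → BModule k R),
    Nonempty (M ≃ₗ[R] ((i : Fin m) → ↥(T i))) ∧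
    (∀ i, IsBrickOver k R ↥(T i)) ∧
    ∀ i j, IsEmpty (↥(T i) ≃ₗ[R] ↥(T j)) → ∀ f : ↥(T i) →ₗ[R] ↥(T j), f = 0

/-- `V` is one-dimensional over `k`. -/
def OneDimOver (V : Type) [AddCommGroup V] [Module k V] : Prop :=
  ∃ v : V, v ≠ 0 ∧ ∀ w : V, ∃ c : k, w = c • v

/-- Triviality of the second group cohomology `H²(Q, kˣ)` (trivial action):
every `2`-cocycle is a `2`-coboundary. -/
def H2Trivial (Q : Type) [Group Q] : Prop :=
  ∀ α : Q → Q → kˣ,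
    (∀ a b c : Q, α a b * α (a * b) c = α b c * α a (b * c)) →
    ∃ β : Q → kˣ, ∀ a b : Q, α a b = β a * β b * (β (a * b))⁻¹

/-- The `k`-algebra `R` is basic (for `k` algebraically closed this means that
every simple module is one-dimensional over `k`). -/
def BasicAlg (R : Type) [Ring R] [Algebra k R] : Prop :=
  ∀ V : BModule k R, IsSimpleModule R ↥V → OneDimOver k ↥V

/-- `P` has exactly `n` isomorphism classes of modules satisfying it. -/
def RepClasses (R : Type) [Ring R] [Algebra k R]
    (P : BModule k R → Prop) (n : ℕ) : Prop :=
  ∃ V : Fin n → BModule k R, (∀ i, P (V i)) ∧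
    (∀ i j, i ≠ j → IsEmpty (↥(V i) ≃ₗ[R] ↥(V j))) ∧
    ∀ W : BModule k R, P W → ∃ i, Nonempty (↥W ≃ₗ[R] ↥(V i))

/-- The ring homomorphism `k[A] → k[B]` induced by a group homomorphism `f : A → B`. -/
noncomputable def MapAlong {A B : Type} [Group A] [Group B] (f : A →* B) :
    MonoidAlgebra k A →+* MonoidAlgebra k B :=
  MonoidAlgebra.mapDomainRingHom k f

/-- The `k[B]`-module `W` restricted along `f : A → B` is isomorphic to the
`k[A]`-module `U`; i.e. `W` is an extending module of `U`. -/
def ExtendsAlong {A B : Type} [Group A] [Group B] (f : A →* B)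
    (U : Type) [AddCommGroup U] [Module (MonoidAlgebra k A) U]
    (W : Type) [AddCommGroup W] [Module (MonoidAlgebra k B) W] : Prop :=
  ∃ φ : U ≃+ W, ∀ (a : MonoidAlgebra k A) (u : U),
    φ (a • u) = MapAlong k f a • φ u

/-- `η : U →+ W` exhibits the `k[B]`-module `W` as the module induced along
`f : A → B` from the `k[A]`-module `U`: `η` is `k[A]`-linear into the restriction
of `W`, and has the universal (left-adjoint) property. -/
def IsInducedUnit {A B : Type} [Group A] [Group B] (f : A →* B)
    (U : Type) [AddCommGroup U] [Module (MonoidAlgebra k A) U]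
    (W : Type) [AddCommGroup W] [Module (MonoidAlgebra k B) W]
    (η : U →+ W) : Prop :=
  (∀ (a : MonoidAlgebra k A) (u : U), η (a • u) = MapAlong k f a • η u) ∧
  ∀ (X : BModule k (MonoidAlgebra k B)) (g : U →+ ↥X),
    (∀ (a : MonoidAlgebra k A) (u : U), g (a • u) = MapAlong k f a • g u) →
    ∃! F : W →ₗ[MonoidAlgebra k B] ↥X, ∀ u : U, F (η u) = g u

/-- `W` is (a realization of) the induced module `Ind` of `U` along `f`. -/
def IsInducedAlong {A B : Type} [Group A] [Group B] (f : A →* B)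
    (U : Type) [AddCommGroup U] [Module (MonoidAlgebra k A) U]
    (W : Type) [AddCommGroup W] [Module (MonoidAlgebra k B) W] : Prop :=
  ∃ η : U →+ W, IsInducedUnit k f U W η

variable (Gt : Type) [Group Gt] (G : Subgroup Gt) [G.Normal]

/-- Conjugation `g ↦ x⁻¹ g x` as a homomorphism of the normal subgroup `G`. -/
def conjHom (x : Gt) : ↥G →* ↥G where
  toFun g := ⟨x⁻¹ * ↑g * x, ‹G.Normal›.conj_mem' (↑g) g.2 x⟩
  map_one' := by
    apply Subtype.ext
    simp
  map_mul' g h := by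
    apply Subtype.ext
    push_cast
    group

/-- The `kG`-module `U` is stable under conjugation by `x`, i.e. `ˣU ≅ U`. -/
def IsStableAt (x : Gt) (U : Type) [AddCommGroup U]
    [Module (MonoidAlgebra k ↥G) U] : Prop :=
  ∃ ψ : U ≃+ U, ∀ (a : MonoidAlgebra k ↥G) (u : U),
    ψ (MapAlong k (conjHom Gt G x) a • u) = a • ψ u

/-- The `kG`-module `U` is `G̃`-stable. -/
def IsGtStable (U : Type) [AddCommGroup U]
    [Module (MonoidAlgebra k ↥G) U] : Prop :=
  ∀ x : Gt, IsStableAt k Gt G x U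

/-- The inertia group of an element `b ∈ kG` inside `G̃`:
all `x ∈ G̃` with `x b x⁻¹ = b`. -/
def inertia (b : MonoidAlgebra k ↥G) : Subgroup Gt where
  carrier := {x : Gt | Commute (MonoidAlgebra.of k Gt x) (MapAlong k G.subtype b)}
  one_mem' := by
    simp only [Set.mem_setOf_eq, map_one]
    exact Commute.one_left _
  mul_mem' := by
    intro a c ha hc
    simp only [Set.mem_setOf_eq, map_mul] at *
    exact ha.mul_left hc
  inv_mem' := by
    intro a ha
    simp only [Set.mem_setOf_eq] at *
    have h1 : MonoidAlgebra.of k Gt a⁻¹ * MonoidAlgebra.of k Gt a = 1 := by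
      rw [← map_mul, inv_mul_cancel, map_one]
    have h2 : MonoidAlgebra.of k Gt a * MonoidAlgebra.of k Gt a⁻¹ = 1 := by
      rw [← map_mul, mul_inv_cancel, map_one]
    show MonoidAlgebra.of k Gt a⁻¹ * MapAlong k G.subtype b
        = MapAlong k G.subtype b * MonoidAlgebra.of k Gt a⁻¹
    calc MonoidAlgebra.of k Gt a⁻¹ * MapAlong k G.subtype b
        = MonoidAlgebra.of k Gt a⁻¹ * MapAlong k G.subtype b *
            (MonoidAlgebra.of k Gt a * MonoidAlgebra.of k Gt a⁻¹) := by
          rw [h2, mul_one]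
      _ = MonoidAlgebra.of k Gt a⁻¹ * (MapAlong k G.subtype b * MonoidAlgebra.of k Gt a) *
            MonoidAlgebra.of k Gt a⁻¹ := by noncomm_ring
      _ = MonoidAlgebra.of k Gt a⁻¹ * (MonoidAlgebra.of k Gt a * MapAlong k G.subtype b) *
            MonoidAlgebra.of k Gt a⁻¹ := by rw [← ha.eq]
      _ = (MonoidAlgebra.of k Gt a⁻¹ * MonoidAlgebra.of k Gt a) *
            (MapAlong k G.subtype b * MonoidAlgebra.of k Gt a⁻¹) := by noncomm_ring
      _ = MapAlong k G.subtype b * MonoidAlgebra.of k Gt a⁻¹ := by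
          rw [h1, one_mul]

/-- Relative projectivity of a `k[A]`-module with respect to a subgroup `D ≤ A`:
any `k[A]`-linear surjection onto a quotient admitting a `k[D]`-linear splitting of
a lifting problem admits a `k[A]`-linear solution. -/
def RelProj (A : Type) [Group A] (D : Subgroup A)
    (U : Type) [AddCommGroup U] [Module (MonoidAlgebra k A) U] : Prop :=
  ∀ (M N : BModule k (MonoidAlgebra k A))
    (f : ↥M →ₗ[MonoidAlgebra k A] ↥N) (g : U →ₗ[MonoidAlgebra k A] ↥N),
    Function.Surjective f →
    (∃ h : U →+ ↥M,
        (∀ (c : k) (u : U),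
          h (algebraMap k (MonoidAlgebra k A) c • u)
            = algebraMap k (MonoidAlgebra k A) c • h u) ∧
        (∀ (d : ↥D) (u : U),
          h (MonoidAlgebra.of k A ↑d • u) = MonoidAlgebra.of k A ↑d • h u) ∧
        ∀ u : U, f (h u) = g u) →
    ∃ h' : U →ₗ[MonoidAlgebra k A] ↥M, ∀ u : U, f (h' u) = g u

/-- `D` is a defect group of the block of `b`: `D` is minimal with respect to
inclusion among subgroups such that every module in the block is relatively
`D`-projective. -/
def IsDefectGroup (A : Type) [Group A] (b : MonoidAlgebra k A)
    (D : Subgroup A) : Prop :=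
  (∀ U : BModule k (MonoidAlgebra k A),
      LiesIn (MonoidAlgebra k A) b ↥U → RelProj k A D ↥U) ∧
  ∀ D' : Subgroup A, D' ≤ D →
    (∀ U : BModule k (MonoidAlgebra k A),
        LiesIn (MonoidAlgebra k A) b ↥U → RelProj k A D' ↥U) →
    D' = D

/-- Left finiteness (inside the ambient class `Amb`) of a module `S`: the smallest
torsion class containing `S` is functorially finite. -/
def IsLeftFiniteIn (R : Type) [Ring R] (Amb : ModuleCat.{0} R → Prop)
    (S : Type) [AddCommGroup S] [Module R S] : Prop :=
  FunctoriallyFinite R Amb (TorsClIn R Amb (fun X => Nonempty (↥X ≃ₗ[R] S)))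

/-- `W₂` realizes the tensor product `W₁ ⊗ₖ V` with the diagonal `G̃`-action, where
`V` is a `k[G̃/G]`-module viewed as a `k[G̃]`-module via the projection. -/
def DiagTensorIso
    (W₁ : Type) [AddCommGroup W₁] [Module k W₁] [Module (MonoidAlgebra k Gt) W₁]
    [IsScalarTower k (MonoidAlgebra k Gt) W₁]
    (V : Type) [AddCommGroup V] [Module k V] [Module (MonoidAlgebra k (Gt ⧸ G)) V]
    [IsScalarTower k (MonoidAlgebra k (Gt ⧸ G)) V]
    (W₂ : Type) [AddCommGroup W₂] [Module k W₂] [Module (MonoidAlgebra k Gt) W₂]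
    [IsScalarTower k (MonoidAlgebra k Gt) W₂] : Prop :=
  ∃ θ : (W₁ ⊗[k] V) ≃ₗ[k] W₂,
    ∀ (x : Gt) (w : W₁) (v : V),
      θ ((MonoidAlgebra.of k Gt x • w) ⊗ₜ[k]
          (MonoidAlgebra.of k (Gt ⧸ G) (QuotientGroup.mk x) • v))
        = MonoidAlgebra.of k Gt x • θ (w ⊗ₜ[k] v)

end GroupAlg

/-! ### Torsion classes in the module category of a block -/

section TorsionClasses

variable {R : Type} [Ring R] {b : R}

section Block

variable {M N : Type} [AddCommGroup M] [Module R M] [AddCommGroup N] [Module R N]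

lemma BlockFG.of_surjective (f : M →ₗ[R] N) (hf : Function.Surjective f)
    (h : BlockFG R b (ModuleCat.of R M)) : BlockFG R b (ModuleCat.of R N) := by
  obtain ⟨h1, h2⟩ := h
  have : Module.Finite R M := h1
  refine ⟨Module.Finite.of_surjective f hf, fun u => ?_⟩
  obtain ⟨m, rfl⟩ := hf u
  rw [← map_smul]
  exact congrArg f (h2 m)

lemma BlockFG.of_injective [IsNoetherianRing R] (f : M →ₗ[R] N) (hf : Function.Injective f)
    (h : BlockFG R b (ModuleCat.of R N)) : BlockFG R b (ModuleCat.of R M) := by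
  obtain ⟨h1, h2⟩ := h
  have : Module.Finite R N := h1
  refine ⟨Module.Finite.of_injective f hf, fun u => hf ?_⟩
  rw [map_smul]
  exact h2 (f u)

lemma BlockFG.prod (hM : BlockFG R b (ModuleCat.of R M)) (hN : BlockFG R b (ModuleCat.of R N)) :
    BlockFG R b (ModuleCat.of R (M × N)) := by
  have : Module.Finite R M := hM.1
  have : Module.Finite R N := hN.1
  exact ⟨inferInstanceAs (Module.Finite R (M × N)), fun u => Prod.ext (hM.2 u.1) (hN.2 u.2)⟩

lemma BlockFG.pi {ι : Type} [Finite ι] (X : ι → Type) [∀ i, AddCommGroup (X i)]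
    [∀ i, Module R (X i)] (h : ∀ i, BlockFG R b (ModuleCat.of R (X i))) :
    BlockFG R b (ModuleCat.of R ((i : ι) → X i)) := by
  have : ∀ i, Module.Finite R (X i) := fun i => (h i).1
  exact ⟨inferInstanceAs (Module.Finite R ((i : ι) → X i)),
    fun u => funext fun i => (h i).2 (u i)⟩

end Block

/-- A torsion class of finitely generated modules in the block of `b`. -/
abbrev IsTors (b : R) (T : ModuleCat.{0} R → Prop) : Prop :=
  IsTorsionClassIn R (BlockFG R b) T

namespace IsTors

variable {T : ModuleCat.{0} R → Prop}
  {M N A C : Type} [AddCommGroup M] [Module R M] [AddCommGroup N] [Module R N]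
  [AddCommGroup A] [Module R A] [AddCommGroup C] [Module R C]

lemma block (hT : IsTors b T) (h : T (ModuleCat.of R M)) : BlockFG R b (ModuleCat.of R M) :=
  hT.1 _ h

lemma of_surjective (hT : IsTors b T) (f : M →ₗ[R] N) (hf : Function.Surjective f)
    (h : T (ModuleCat.of R M)) : T (ModuleCat.of R N) :=
  hT.2.1 (ModuleCat.of R M) (ModuleCat.of R N) f ((hT.block h).of_surjective f hf) hf h

lemma range (hT : IsTors b T) (f : M →ₗ[R] N) (h : T (ModuleCat.of R M)) :
    T (ModuleCat.of R (LinearMap.range f)) :=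
  hT.of_surjective f.rangeRestrict f.surjective_rangeRestrict h

lemma ext (hT : IsTors b T) (i : A →ₗ[R] M) (q : M →ₗ[R] C)
    (hiq : LinearMap.ker q = LinearMap.range i) (hq : Function.Surjective q)
    (hM : BlockFG R b (ModuleCat.of R M))
    (hA : T (ModuleCat.of R A)) (hC : T (ModuleCat.of R C)) : T (ModuleCat.of R M) := by
  refine hT.2.2.2 (ModuleCat.of R M) (LinearMap.ker q) hM ?_ ?_
  · have := hT.range i hA
    rw [← hiq] at this
    exact this
  · exact hT.of_surjective (q.quotKerEquivOfSurjective hq).symm.toLinearMap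
      (q.quotKerEquivOfSurjective hq).symm.surjective hC

lemma prod (hT : IsTors b T) (hM : T (ModuleCat.of R M)) (hN : T (ModuleCat.of R N)) :
    T (ModuleCat.of R (M × N)) :=
  hT.ext (LinearMap.inl R M N) (LinearMap.snd R M N) (LinearMap.range_inl R M N).symm
    Prod.snd_surjective ((hT.block hM).prod (hT.block hN)) hM hN

lemma pi (hT : IsTors b T) {n : ℕ} (X : Fin n → Type) [∀ i, AddCommGroup (X i)]
    [∀ i, Module R (X i)] (h : ∀ i, T (ModuleCat.of R (X i))) :
    T (ModuleCat.of R ((i : Fin n) → X i)) :=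
  hT.2.2.1 n (fun i => ModuleCat.of R (X i)) h (BlockFG.pi X fun i => hT.block (h i))

lemma sup (hT : IsTors b T) (L₁ L₂ : Submodule R M) (h₁ : T (ModuleCat.of R L₁))
    (h₂ : T (ModuleCat.of R L₂)) : T (ModuleCat.of R (L₁ ⊔ L₂ : Submodule R M)) := by
  have := hT.range (L₁.subtype.coprod L₂.subtype) (hT.prod h₁ h₂)
  rwa [LinearMap.range_coprod, Submodule.range_subtype, Submodule.range_subtype] at this

lemma bot (hT : IsTors b T) : T (ModuleCat.of R (⊥ : Submodule R M)) :=
  hT.of_surjective (M := (i : Fin 0) → (fun _ => R) i) 0 (fun _ => ⟨0, Subsingleton.elim _ _⟩)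
    (hT.pi (fun _ => R) (fun i => i.elim0))

/-- Every module in the block has a largest submodule in a given torsion class. -/
lemma exists_torsionPart [IsNoetherianRing R] (hT : IsTors b T)
    (hM : BlockFG R b (ModuleCat.of R M)) :
    ∃ t : Submodule R M, T (ModuleCat.of R t) ∧
      ∀ L : Submodule R M, T (ModuleCat.of R L) → L ≤ t := by
  have : Module.Finite R M := hM.1
  obtain ⟨t, ht, hmax⟩ := (wellFounded_gt (α := Submodule R M)).has_min
    {L | T (ModuleCat.of R L)} ⟨⊥, hT.bot⟩
  refine ⟨t, ht, fun L hL => ?_⟩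
  by_contra hcon
  exact hmax (t ⊔ L) (hT.sup _ _ ht hL) (left_lt_sup.mpr hcon)

lemma of_torsionPart_eq_top (hT : IsTors b T) {t : Submodule R M} (ht : T (ModuleCat.of R t))
    (h : t = ⊤) : T (ModuleCat.of R M) :=
  hT.of_surjective t.subtype (by rw [← LinearMap.range_eq_top, Submodule.range_subtype, h]) ht

lemma contravariantlyFinite [IsNoetherianRing R] (hT : IsTors b T) :
    ContravariantlyFinite R (BlockFG R b) T := by
  intro M hM
  obtain ⟨t, ht, hmax⟩ := hT.exists_torsionPart (M := M) hM
  refine ⟨ModuleCat.of R t, ht, t.subtype, fun Y hY g => ?_⟩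
  have hg : ∀ y, g y ∈ t := fun y => hmax _ (hT.range (M := Y) g hY) ⟨y, rfl⟩
  exact ⟨g.codRestrict t hg, fun y => rfl⟩

end IsTors

variable {C : ModuleCat.{0} R → Prop}

lemma isTors_blockFG : IsTors b (BlockFG R b) :=
  ⟨fun _ h => h, fun _ _ _ h _ _ => h, fun _ _ _ h => h, fun _ _ h _ _ => h⟩

lemma isTors_torsClIn : IsTors b (TorsClIn R (BlockFG R b) C) := by
  refine ⟨fun M h => h _ isTors_blockFG fun X hX _ => hX, ?_, ?_, ?_⟩
  · intro M N f hN hf hM T hT hC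
    exact hT.2.1 M N f hN hf (hM T hT hC)
  · intro n N hN h T hT hC
    exact hT.2.2.1 n N (fun i => hN i T hT hC) h
  · intro M A hM hA hQ T hT hC
    exact hT.2.2.2 M A hM (hA T hT hC) (hQ T hT hC)

/-- Lifting along surjections with kernel in `T`, i.e. Ext-projectivity relative to `T`. -/
def ExtProj (T : ModuleCat.{0} R → Prop) (M : Type) [AddCommGroup M] [Module R M] : Prop :=
  ∀ (Y Z : Type) [AddCommGroup Y] [Module R Y] [AddCommGroup Z] [Module R Z]
    (g : Y →ₗ[R] Z) (f : M →ₗ[R] Z), T (ModuleCat.of R Y) → Function.Surjective g →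
    T (ModuleCat.of R (LinearMap.ker g)) → ∃ h : M →ₗ[R] Y, g ∘ₗ h = f

lemma ExtProj.of_retract {T : ModuleCat.{0} R → Prop} {M N : Type} [AddCommGroup M] [Module R M]
    [AddCommGroup N] [Module R N] (h : ExtProj T M) (i : N →ₗ[R] M) (r : M →ₗ[R] N)
    (hri : r ∘ₗ i = LinearMap.id) : ExtProj T N := by
  intro Y Z _ _ _ _ g f hY hg hk
  obtain ⟨l, hl⟩ := h Y Z g (f ∘ₗ r) hY hg hk
  exact ⟨l ∘ₗ i, by rw [← LinearMap.comp_assoc, hl, LinearMap.comp_assoc, hri, LinearMap.comp_id]⟩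

/-- `a` is a universal element of `X` among elements of modules in `T`. -/
def IsGenPoint (T : ModuleCat.{0} R → Prop) (X : Type) [AddCommGroup X] [Module R X]
    (a : X) : Prop :=
  ∀ (Y : Type) [AddCommGroup Y] [Module R Y] (y : Y), T (ModuleCat.of R Y) →
    ∃ h : X →ₗ[R] Y, h a = y

lemma exists_isGenPoint {T : ModuleCat.{0} R → Prop} (hb : IsCentralIdem R b) (hT : IsTors b T)
    (hcov : CovariantlyFinite R (BlockFG R b) T) :
    ∃ (X : ModuleCat.{0} R) (a : X), T X ∧ IsGenPoint T X a := by
  have hP : BlockFG R b (ModuleCat.of R (Submodule.span R {b})) := by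
    refine ⟨inferInstanceAs (Module.Finite R (Submodule.span R {b})), fun u => ?_⟩
    obtain ⟨u, hu⟩ := u
    obtain ⟨r, rfl⟩ := Submodule.mem_span_singleton.mp hu
    refine Subtype.ext ?_
    change b * (r * b) = r * b
    rw [← hb.2, mul_assoc, hb.1]
  obtain ⟨X, hX, f, hf⟩ := hcov _ hP
  let β : Submodule.span R {b} := ⟨b, Submodule.mem_span_singleton_self b⟩
  refine ⟨X, f β, hX, fun Y _ _ y hY => ?_⟩
  obtain ⟨h, hh⟩ := hf (ModuleCat.of R Y) hY
    (LinearMap.toSpanSingleton R Y y ∘ₗ (Submodule.span R {b}).subtype)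
  exact ⟨h, (hh β).trans ((hT.block hY).2 y)⟩

/-- A torsion class that is covariantly finite has an Ext-projective pointed generator. -/
lemma exists_extProj_isGenPoint [IsArtinianRing R] {T : ModuleCat.{0} R → Prop}
    (hb : IsCentralIdem R b) (hT : IsTors b T) (hcov : CovariantlyFinite R (BlockFG R b) T) :
    ∃ (X : ModuleCat.{0} R) (a : X), T X ∧ IsGenPoint T X a ∧ ExtProj T X := by
  obtain ⟨⟨X, a⟩, ⟨hX, ha⟩, hmin⟩ := (InvImage.wf (fun p : Σ X : ModuleCat.{0} R, X =>
    Module.length R p.1) (wellFounded_lt (α := ℕ∞))).has_min {p | T p.1 ∧ IsGenPoint T p.1 p.2}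
    (by obtain ⟨X, a, h⟩ := exists_isGenPoint hb hT hcov; exact ⟨⟨X, a⟩, h⟩)
  refine ⟨X, a, hX, ha, ?_⟩
  have hXf : Module.Finite R X := (hT.1 _ hX).1
  dsimp only at hX ha
  intro Y Z _ _ _ _ g f hY hg hk
  let E : Submodule R (X × Y) := LinearMap.ker (f.coprod (-g))
  have hE : ∀ x y, (x, y) ∈ E ↔ f x = g y := by
    intro x y
    simp [E, ← sub_eq_add_neg, sub_eq_zero]
  have hET : T (ModuleCat.of R E) := by
    let q : E →ₗ[R] X := LinearMap.fst R X Y ∘ₗ E.subtype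
    let i : LinearMap.ker g →ₗ[R] E :=
      (LinearMap.inr R X Y ∘ₗ (LinearMap.ker g).subtype).codRestrict E fun c => by
        have := c.2
        rw [LinearMap.mem_ker] at this
        exact (hE _ _).mpr (by simp [this])
    refine hT.ext i q ?_ ?_ ?_ hk (show T (ModuleCat.of R X) from hX)
    · ext ⟨⟨x, y⟩, hxy⟩
      simp only [LinearMap.mem_ker, LinearMap.mem_range]
      constructor
      · intro hx
        have hx : x = 0 := hx
        subst hx
        exact ⟨⟨y, by rw [LinearMap.mem_ker, ← (hE _ _).mp hxy, map_zero]⟩, rfl⟩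
      · rintro ⟨c, hc⟩
        rw [← hc]
        rfl
    · intro x
      obtain ⟨y, hy⟩ := hg (f x)
      exact ⟨⟨(x, y), (hE _ _).mpr hy.symm⟩, rfl⟩
    · exact ((hT.block (M := X) hX).prod (hT.block hY)).of_injective E.subtype
        E.injective_subtype
  obtain ⟨y₀, hy₀⟩ := hg (f a)
  obtain ⟨h, hh⟩ := ha E ⟨(a, y₀), (hE _ _).mpr hy₀.symm⟩ hET
  let e : X →ₗ[R] X := LinearMap.fst R X Y ∘ₗ E.subtype ∘ₗ h
  have hea : e a = a := by
    change (h a).1.1 = a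
    rw [hh]
  have hsurj : LinearMap.range e = ⊤ := by
    by_contra hcon
    refine hmin ⟨ModuleCat.of R (LinearMap.range e), ⟨a, a, hea⟩⟩ ⟨?_, ?_⟩
      (Submodule.length_lt hcon)
    · exact hT.range (M := X) e hX
    · intro W _ _ w hW
      obtain ⟨l, hl⟩ := ha W w hW
      exact ⟨l ∘ₗ (LinearMap.range e).subtype, hl⟩
  have hbij : Function.Bijective e :=
    IsNoetherian.bijective_of_surjective_endomorphism e (LinearMap.range_eq_top.mp hsurj)
  let ε := LinearEquiv.ofBijective e hbij
  refine ⟨LinearMap.snd R X Y ∘ₗ E.subtype ∘ₗ h ∘ₗ ε.symm.toLinearMap, LinearMap.ext fun x => ?_⟩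
  have h1 : f (h (ε.symm x)).1.1 = g (h (ε.symm x)).1.2 := (hE _ _).mp (h (ε.symm x)).2
  have h2 : (h (ε.symm x)).1.1 = x := ε.apply_symm_apply x
  rw [h2] at h1
  exact h1.symm

end TorsionClasses

section Covers

variable {R : Type} [Ring R] {b : R}

/-- Every endomorphism is nilpotent or bijective. -/
def FittingLocal (R M : Type) [Ring R] [AddCommGroup M] [Module R M] : Prop :=
  ∀ f : Module.End R M, IsNilpotent f ∨ Function.Bijective f

section Semibrick

variable {n : ℕ} {S : Fin n → Type} [∀ i, AddCommGroup (S i)] [∀ i, Module R (S i)]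

/-- In the torsion class generated by a semibrick, a nonzero map to a brick is surjective with
kernel in the torsion class. -/
lemma eq_zero_or_surjective_of_torsCl [IsNoetherianRing R]
    (hS : ∀ i j (f : S i →ₗ[R] S j), f = 0 ∨ Function.Bijective f)
    {Y : Type} [AddCommGroup Y] [Module R Y]
    (hY : TorsClIn R (BlockFG R b) (fun X => Nonempty (X ≃ₗ[R] ((i : Fin n) → S i)))
      (ModuleCat.of R Y)) (j : Fin n) (f : Y →ₗ[R] S j) :
    f = 0 ∨ Function.Surjective f ∧
      TorsClIn R (BlockFG R b) (fun X => Nonempty (X ≃ₗ[R] ((i : Fin n) → S i)))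
        (ModuleCat.of R (LinearMap.ker f)) := by
  set T := TorsClIn R (BlockFG R b) (fun X => Nonempty (X ≃ₗ[R] ((i : Fin n) → S i))) with hTdef
  have hT : IsTors b T := isTors_torsClIn
  have hquot : ∀ (M N : Type) [AddCommGroup M] [Module R M] [AddCommGroup N] [Module R N]
      (g : M →ₗ[R] N), Function.Surjective g →
      (∀ f : M →ₗ[R] S j, f = 0 ∨ Function.Surjective f ∧
        T (ModuleCat.of R (LinearMap.ker f))) →
      ∀ f : N →ₗ[R] S j, f = 0 ∨ Function.Surjective f ∧
        T (ModuleCat.of R (LinearMap.ker f)) := by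
    intro M N _ _ _ _ g hg hM f
    rcases hM (f ∘ₗ g) with h | ⟨h1, h2⟩
    · left
      ext x
      obtain ⟨m, rfl⟩ := hg x
      exact LinearMap.congr_fun h m
    · right
      refine ⟨fun s => (h1 s).imp' g fun _ => id, ?_⟩
      have hmem : ∀ c : LinearMap.ker (f ∘ₗ g), g c ∈ LinearMap.ker f := fun c => c.2
      refine hT.of_surjective ((g ∘ₗ (LinearMap.ker (f ∘ₗ g)).subtype).codRestrict _ hmem) ?_ h2
      rintro ⟨y, hy⟩
      obtain ⟨m, rfl⟩ := hg y
      exact ⟨⟨m, hy⟩, rfl⟩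
  have hext : ∀ (A M C : Type) [AddCommGroup M] [Module R M] [AddCommGroup A] [Module R A]
      [AddCommGroup C] [Module R C] (i : A →ₗ[R] M) (q : M →ₗ[R] C),
      LinearMap.ker q = LinearMap.range i → Function.Surjective q →
      T (ModuleCat.of R A) → T (ModuleCat.of R M) →
      (∀ f : A →ₗ[R] S j, f = 0 ∨ Function.Surjective f ∧
        T (ModuleCat.of R (LinearMap.ker f))) →
      (∀ f : C →ₗ[R] S j, f = 0 ∨ Function.Surjective f ∧
        T (ModuleCat.of R (LinearMap.ker f))) →
      ∀ f : M →ₗ[R] S j, f = 0 ∨ Function.Surjective f ∧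
        T (ModuleCat.of R (LinearMap.ker f)) := by
    intro A M C _ _ _ _ _ _ i q hiq hq hA hM hA' hC' f
    have hqi : ∀ a, q (i a) = 0 := fun a => by
      rw [← LinearMap.mem_ker, hiq]
      exact ⟨a, rfl⟩
    have hMb := hT.block hM
    rcases hA' (f ∘ₗ i) with h | ⟨h1, h2⟩
    · have hle : LinearMap.ker q ≤ LinearMap.ker f := by
        rw [hiq]
        rintro _ ⟨a, rfl⟩
        exact LinearMap.congr_fun h a
      let f' : C →ₗ[R] S j :=
        (LinearMap.ker q).liftQ f hle ∘ₗ (q.quotKerEquivOfSurjective hq).symm.toLinearMap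
      have hf' : ∀ m, f' (q m) = f m := by
        intro m
        have : (q.quotKerEquivOfSurjective hq).symm (q m) = Submodule.Quotient.mk m := by
          rw [LinearEquiv.symm_apply_eq]
          rfl
        change (LinearMap.ker q).liftQ f hle ((q.quotKerEquivOfSurjective hq).symm (q m)) = f m
        rw [this]
        rfl
      rcases hC' f' with h0 | ⟨h3, h4⟩
      · left
        ext m
        rw [← hf', h0]
        rfl
      · right
        refine ⟨fun s => ?_, ?_⟩
        · obtain ⟨c, rfl⟩ := h3 s
          obtain ⟨m, rfl⟩ := hq c
          exact ⟨m, (hf' m).symm⟩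
        · refine hT.ext
            (i.codRestrict (LinearMap.ker f) fun a => hle (LinearMap.mem_ker.mpr (hqi a)))
            ((q ∘ₗ (LinearMap.ker f).subtype).codRestrict (LinearMap.ker f') fun m => ?_)
            ?_ ?_ (hMb.of_injective (LinearMap.ker f).subtype (Submodule.injective_subtype _)) hA h4
          · rw [LinearMap.mem_ker]
            exact (hf' m).trans m.2
          · rw [LinearMap.ker_codRestrict, LinearMap.range_codRestrict, LinearMap.ker_comp, hiq]
          · rintro ⟨c, hc⟩
            obtain ⟨m, rfl⟩ := hq c
            rw [LinearMap.mem_ker, hf'] at hc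
            exact ⟨⟨m, hc⟩, rfl⟩
    · right
      refine ⟨fun s => (h1 s).imp' i fun _ => id, ?_⟩
      refine hT.ext
        ((i ∘ₗ (LinearMap.ker (f ∘ₗ i)).subtype).codRestrict (LinearMap.ker f) fun a => a.2)
        (q ∘ₗ (LinearMap.ker f).subtype) ?_ ?_
        (hMb.of_injective (LinearMap.ker f).subtype (Submodule.injective_subtype _)) h2
        (hT.of_surjective q hq hM)
      · ext ⟨m, hm⟩
        constructor
        · intro hx
          have hx : m ∈ LinearMap.ker q := hx
          rw [hiq] at hx
          obtain ⟨a, rfl⟩ := hx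
          exact ⟨⟨a, hm⟩, rfl⟩
        · rintro ⟨a, ha⟩
          rw [← ha]
          exact hqi a
      · intro c
        obtain ⟨m, rfl⟩ := hq c
        obtain ⟨a, ha⟩ := h1 (f m)
        refine ⟨⟨m - i a, ?_⟩, ?_⟩
        · rw [LinearMap.mem_ker, map_sub, sub_eq_zero]
          exact ha.symm
        · change q (m - i a) = q m
          rw [map_sub, hqi, sub_zero]
  have hpi : ∀ (m : ℕ) (X : Fin m → ModuleCat.{0} R), (∀ l, T (X l)) →
      (∀ l, ∀ f : X l →ₗ[R] S j, f = 0 ∨ Function.Surjective f ∧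
        T (ModuleCat.of R (LinearMap.ker f))) →
      ∀ f : ((l : Fin m) → X l) →ₗ[R] S j, f = 0 ∨ Function.Surjective f ∧
        T (ModuleCat.of R (LinearMap.ker f)) := by
    intro m
    induction m with
    | zero => exact fun X _ _ f => Or.inl (LinearMap.ext fun x => by
        rw [Subsingleton.elim x 0, map_zero, map_zero])
    | succ m ih =>
      intro X hX hX'
      let q : ((l : Fin (m + 1)) → X l) →ₗ[R] ((l : Fin m) → X l.succ) :=
        LinearMap.pi fun l => LinearMap.proj l.succ
      refine hext (X 0) _ ((l : Fin m) → X l.succ) (LinearMap.single R (fun l => X l) 0) q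
        ?_ ?_ (hX 0) (hT.pi (fun l => X l) hX) (hX' 0) (ih _ (fun l => hX _) fun l => hX' _)
      · ext x
        constructor
        · intro hx
          refine ⟨x 0, ?_⟩
          ext l
          refine Fin.cases ?_ (fun l => ?_) l
          · simp
          · have : q x l = 0 := by rw [LinearMap.mem_ker.mp hx]; rfl
            rw [LinearMap.single_apply, Pi.single_eq_of_ne (Fin.succ_ne_zero l)]
            exact this.symm
        · rintro ⟨x, rfl⟩
          rw [LinearMap.mem_ker]
          ext l
          exact Pi.single_eq_of_ne (M := fun l => X l) (Fin.succ_ne_zero l) x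
      · intro y
        exact ⟨Fin.cons 0 y, rfl⟩
  let T' : ModuleCat.{0} R → Prop := fun Y => T Y ∧ ∀ f : Y →ₗ[R] S j,
    f = 0 ∨ Function.Surjective f ∧ T (ModuleCat.of R (LinearMap.ker f))
  have hT' : IsTors b T' := by
    refine ⟨fun M h => hT.1 M h.1, ?_, ?_, ?_⟩
    · intro M N g hN hg hM
      exact ⟨hT.2.1 M N g hN hg hM.1, hquot M N g hg hM.2⟩
    · intro m X hX hb
      exact ⟨hT.2.2.1 m X (fun l => (hX l).1) hb, hpi m X (fun l => (hX l).1) fun l => (hX l).2⟩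
    · intro M A hM hA hC
      have hTM := hT.2.2.2 M A hM hA.1 hC.1
      exact ⟨hTM, hext A M (M ⧸ A) A.subtype A.mkQ (by simp) A.mkQ_surjective hA.1 hTM hA.2 hC.2⟩
  refine (hY T' hT' ?_).2 f
  rintro X hX ⟨e⟩
  have hTX : T X := fun T₁ hT₁ hC => hC X hX ⟨e⟩
  have hTP : T (ModuleCat.of R ((i : Fin n) → S i)) :=
    hT.of_surjective (M := X) e.toLinearMap e.surjective hTX
  have hTS : ∀ i, T (ModuleCat.of R (S i)) := fun i =>
    hT.of_surjective (LinearMap.proj i) (Function.surjective_eval i) hTP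
  refine ⟨hTX, hquot _ X e.symm.toLinearMap e.symm.surjective
    (hpi n (fun i => ModuleCat.of R (S i)) hTS fun i f => ?_)⟩
  refine (hS i j f).imp id fun h => ⟨h.2, ?_⟩
  rw [LinearMap.ker_eq_bot.mpr h.1]
  exact hT.bot

end Semibrick

/-- An Ext-projective cover of a module `V` in a torsion class `T`. -/
lemma exists_extProj_cover [IsArtinianRing R] {T : ModuleCat.{0} R → Prop}
    (hb : IsCentralIdem R b) (hT : IsTors b T) (hcov : CovariantlyFinite R (BlockFG R b) T)
    {V : Type} [AddCommGroup V] [Module R V] [Nontrivial V] (hV : T (ModuleCat.of R V)) :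
    ∃ M : ModuleCat.{0} R, T M ∧ ExtProj T M ∧ FittingLocal R M ∧ ∃ q : M →ₗ[R] V, q ≠ 0 := by
  obtain ⟨M, ⟨hM, hE, q, hq⟩, hmin⟩ := (InvImage.wf (fun M : ModuleCat.{0} R =>
    Module.length R M) (wellFounded_lt (α := ℕ∞))).has_min
    {M | T M ∧ ExtProj T M ∧ ∃ q : M →ₗ[R] V, q ≠ 0} (by
      obtain ⟨X, a, hX, ha, hE⟩ := exists_extProj_isGenPoint hb hT hcov
      obtain ⟨v, hv⟩ := exists_ne (0 : V)
      obtain ⟨h, hh⟩ := ha V v hV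
      exact ⟨X, hX, hE, h, fun h0 => hv (by rw [← hh, h0]; rfl)⟩)
  have hMf : Module.Finite R M := (hT.1 _ hM).1
  refine ⟨M, hM, hE, fun f => ?_, q, hq⟩
  obtain ⟨m, hm⟩ := Filter.eventually_atTop.mp (LinearMap.eventually_isCompl_ker_pow_range_pow f)
  have hc := hm (m + 1) (Nat.le_succ m)
  have key : ∀ A C : Submodule R M, IsCompl A C → A = ⊤ ∨ ∀ x ∈ A, q x = 0 := by
    intro A C hAC
    by_contra! hcon
    obtain ⟨hA, x, hx, hqx⟩ := hcon
    refine hmin (ModuleCat.of R A) ⟨?_, ?_, q ∘ₗ A.subtype, fun h0 => ?_⟩ (Submodule.length_lt hA)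
    · exact hT.of_surjective (M := M) (A.projectionOnto C hAC)
        (Submodule.projectionOnto_surjective hAC) hM
    · exact hE.of_retract A.subtype (A.projectionOnto C hAC)
        (Submodule.projectionOnto_comp_subtype hAC)
    · exact hqx (LinearMap.congr_fun h0 ⟨x, hx⟩)
  rcases key _ _ hc with h | h
  · left
    exact ⟨m + 1, LinearMap.ker_eq_top.mp h⟩
  · right
    rcases key _ _ hc.symm with h' | h'
    · have hs : Function.Surjective f := by
        intro x
        obtain ⟨y, rfl⟩ : x ∈ LinearMap.range (f ^ (m + 1)) := h' ▸ Submodule.mem_top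
        exact ⟨(f ^ m) y, by rw [pow_succ']; rfl⟩
      exact IsNoetherian.bijective_of_surjective_endomorphism f hs
    · exfalso
      refine hq (LinearMap.ext fun x => ?_)
      obtain ⟨y, hy, z, hz, rfl⟩ := Submodule.mem_sup.mp
        (show x ∈ LinearMap.ker (f ^ (m + 1)) ⊔ LinearMap.range (f ^ (m + 1)) from
          hc.sup_eq_top ▸ Submodule.mem_top)
      rw [map_add, h y hy, h' z hz, add_zero]
      rfl

/-- The kernel of a cover contains every proper submodule lying in the torsion class. -/
lemma le_ker_of_extProj {T : ModuleCat.{0} R → Prop}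
    {M V : Type} [AddCommGroup M] [Module R M] [AddCommGroup V] [Module R V]
    (hE : ExtProj T M) (hL : FittingLocal R M)
    (hV : ∀ (Y : Type) [AddCommGroup Y] [Module R Y] (f : Y →ₗ[R] V), T (ModuleCat.of R Y) →
      f = 0 ∨ Function.Surjective f ∧ T (ModuleCat.of R (LinearMap.ker f)))
    (q : M →ₗ[R] V) (hq : q ≠ 0) (L : Submodule R M) (hLT : T (ModuleCat.of R L)) (hL' : L ≠ ⊤) :
    L ≤ LinearMap.ker q := by
  rcases hV L (q ∘ₗ L.subtype) hLT with h | ⟨h1, h2⟩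
  · exact fun x hx => LinearMap.congr_fun h ⟨x, hx⟩
  · exfalso
    obtain ⟨l, hl⟩ := hE L V _ q hLT h1 h2
    let e : Module.End R M := L.subtype ∘ₗ l
    have he : q ∘ₗ e = q := hl
    rcases hL e with ⟨m, hm⟩ | h
    · have : ∀ m, q ∘ₗ (e ^ m) = q := by
        intro m
        induction m with
        | zero => rfl
        | succ m ih => rw [pow_succ, Module.End.mul_eq_comp, ← LinearMap.comp_assoc, ih, he]
      refine hq ?_
      rw [← this m, hm, LinearMap.comp_zero]
    · refine hL' (eq_top_iff.mpr fun x _ => ?_)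
      obtain ⟨y, rfl⟩ := h.2 x
      exact (l y).2

end Covers

section Generation

variable {R : Type} [Ring R] {b : R}

/-- The modules in the block generated by `M`. -/
def GenBy (b : R) (M : Type) [AddCommGroup M] [Module R M] (N : ModuleCat.{0} R) : Prop :=
  BlockFG R b N ∧ (⨆ f : M →ₗ[R] N, LinearMap.range f) = ⊤

variable {M N : Type} [AddCommGroup M] [Module R M] [AddCommGroup N] [Module R N]
  {T : ModuleCat.{0} R → Prop}

lemma GenBy.of_surjective {N' : Type} [AddCommGroup N'] [Module R N'] (g : N →ₗ[R] N')
    (hg : Function.Surjective g) (h : GenBy b M (ModuleCat.of R N)) :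
    GenBy b M (ModuleCat.of R N') := by
  refine ⟨h.1.of_surjective g hg, eq_top_iff.mpr ?_⟩
  rw [← LinearMap.range_eq_top.mpr hg, LinearMap.range_eq_map, ← h.2, Submodule.map_iSup]
  refine iSup_le fun f => ?_
  rw [← LinearMap.range_comp]
  exact le_iSup (fun f : M →ₗ[R] N' => LinearMap.range f) (g ∘ₗ f)

lemma genBy_self (hM : BlockFG R b (ModuleCat.of R M)) : GenBy b M (ModuleCat.of R M) :=
  ⟨hM, eq_top_iff.mpr (by
    rw [← LinearMap.range_id]
    exact le_iSup (fun f : M →ₗ[R] M => LinearMap.range f) LinearMap.id)⟩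

lemma IsTors.of_genBy [IsNoetherianRing R] (hT : IsTors b T) (hM : T (ModuleCat.of R M))
    (hN : GenBy b M (ModuleCat.of R N)) : T (ModuleCat.of R N) := by
  obtain ⟨t, ht, hmax⟩ := hT.exists_torsionPart hN.1
  refine hT.of_torsionPart_eq_top ht (eq_top_iff.mpr ?_)
  rw [← hN.2]
  exact iSup_le fun f => hmax _ (hT.range f hM)

/-- The modules generated by an Ext-projective module form a torsion class. -/
lemma isTors_genBy [IsNoetherianRing R] (hT : IsTors b T) (hM : T (ModuleCat.of R M))
    (hE : ExtProj T M) : IsTors b (GenBy b M) := by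
  refine ⟨fun N h => h.1, fun N N' g _ hg h => GenBy.of_surjective (N := N) g hg h, ?_, ?_⟩
  · intro n N hN hb
    refine ⟨hb, ?_⟩
    rw [eq_top_iff]
    intro x _
    rw [← Finset.univ_sum_single x]
    refine Submodule.sum_mem _ fun i _ => ?_
    have h1 : LinearMap.range (LinearMap.single R (fun i => N i) i) ≤
        ⨆ f : M →ₗ[R] ((i : Fin n) → N i), LinearMap.range f := by
      rw [LinearMap.range_eq_map, ← (hN i).2, Submodule.map_iSup]
      refine iSup_le fun f => ?_
      rw [← LinearMap.range_comp]
      exact le_iSup (fun f : M →ₗ[R] ((i : Fin n) → N i) => LinearMap.range f)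
        (LinearMap.single R (fun i => N i) i ∘ₗ f)
    exact h1 ⟨x i, rfl⟩
  · intro N A hN hA hC
    refine ⟨hN, ?_⟩
    have hAT : T (ModuleCat.of R A) := hT.of_genBy hM hA
    have hCT : T (ModuleCat.of R (N ⧸ A)) := hT.of_genBy hM hC
    have hNT : T (ModuleCat.of R N) := hT.2.2.2 N A hN hAT hCT
    have hA' : A ≤ ⨆ f : M →ₗ[R] N, LinearMap.range f := by
      rw [← Submodule.range_subtype A, LinearMap.range_eq_map]
      have h2 : (⨆ f : M →ₗ[R] A, LinearMap.range f) = ⊤ := hA.2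
      rw [← h2, Submodule.map_iSup]
      refine iSup_le fun f => ?_
      rw [← LinearMap.range_comp]
      exact le_iSup (fun f : M →ₗ[R] N => LinearMap.range f) (A.subtype ∘ₗ f)
    have h3 : (⨆ f : M →ₗ[R] N ⧸ A, LinearMap.range f) = ⊤ := hC.2
    have h4 : Submodule.map A.mkQ (⨆ f : M →ₗ[R] N, LinearMap.range f) = ⊤ := by
      rw [eq_top_iff, ← h3]
      refine iSup_le fun f => ?_
      obtain ⟨h, rfl⟩ := hE N (N ⧸ A) A.mkQ f hNT A.mkQ_surjective
        (by rw [Submodule.ker_mkQ]; exact hAT)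
      rw [LinearMap.range_comp]
      exact Submodule.map_mono (le_iSup (fun f : M →ₗ[R] N => LinearMap.range f) h)
    have h5 := congrArg (Submodule.comap A.mkQ) h4
    rw [Submodule.comap_map_mkQ, Submodule.comap_top, sup_eq_right.mpr hA'] at h5
    exact h5

lemma mem_iSup_range_iff {k : Type} [Field k] [Algebra k R] [Module k M] [IsScalarTower k R M]
    {d : ℕ} (m : Fin d → M) (hm : Submodule.span k (Set.range m) = ⊤) (y : N)
    (hy : y ∈ ⨆ f : M →ₗ[R] N, LinearMap.range f) :
    ∃ F : Fin d → (M →ₗ[R] N), y = ∑ i, F i (m i) := by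
  induction hy using Submodule.iSup_induction' with
  | mem f x hx =>
    obtain ⟨x, rfl⟩ := hx
    have hx : x ∈ Submodule.span k (Set.range m) := hm ▸ Submodule.mem_top
    obtain ⟨c, rfl⟩ := (Submodule.mem_span_range_iff_exists_fun k).mp hx
    have hc : ∀ c : k, ∀ (r : R) (x : M), c • r • x = r • c • x := fun c r x => by
      rw [← algebraMap_smul R c x, ← algebraMap_smul R c (r • x), ← mul_smul, ← mul_smul,
        Algebra.commutes]
    let sc : k → (M →ₗ[R] M) := fun c =>
      { toFun := fun x => c • x
        map_add' := smul_add c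
        map_smul' := fun r x => hc c r x }
    exact ⟨fun i => f ∘ₗ sc (c i), by rw [map_sum]; rfl⟩
  | zero => exact ⟨0, by simp⟩
  | add x y _ _ hx hy =>
    obtain ⟨F, rfl⟩ := hx
    obtain ⟨F', rfl⟩ := hy
    exact ⟨F + F', by simp [Finset.sum_add_distrib]⟩

lemma genBy_covariantlyFinite (k : Type) [Field k] [Algebra k R] [Module k M]
    [IsScalarTower k R M] [Module.Finite k M] (hG : IsTors b (GenBy b M))
    (hM : BlockFG R b (ModuleCat.of R M)) :
    CovariantlyFinite R (BlockFG R b) (GenBy b M) := by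
  intro N hN
  have hNf : Module.Finite R N := hN.1
  obtain ⟨n, π, hπ⟩ := Module.Finite.exists_fin' R N
  obtain ⟨d, m, hm⟩ := Module.Finite.exists_fin (R := k) (M := M)
  let W := Fin n → Fin d → M
  let u : (Fin n → R) →ₗ[R] W := LinearMap.pi fun j => LinearMap.pi fun i =>
    LinearMap.toSpanSingleton R M (m i) ∘ₗ LinearMap.proj j
  let L : Submodule R W := (LinearMap.ker π).map u
  have hle : LinearMap.ker π ≤ LinearMap.ker (L.mkQ ∘ₗ u) := by
    intro x hx
    rw [LinearMap.mem_ker, LinearMap.comp_apply, Submodule.mkQ_apply,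
      Submodule.Quotient.mk_eq_zero]
    exact ⟨x, hx, rfl⟩
  let f : N →ₗ[R] W ⧸ L := (LinearMap.ker π).liftQ _ hle ∘ₗ
    (π.quotKerEquivOfSurjective hπ).symm.toLinearMap
  have hf : ∀ x, f (π x) = L.mkQ (u x) := by
    intro x
    have : (π.quotKerEquivOfSurjective hπ).symm (π x) = Submodule.Quotient.mk x := by
      rw [LinearEquiv.symm_apply_eq]
      rfl
    change (LinearMap.ker π).liftQ _ hle ((π.quotKerEquivOfSurjective hπ).symm (π x)) = _
    rw [this]
    rfl
  refine ⟨ModuleCat.of R (W ⧸ L), ?_, f, ?_⟩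
  · exact hG.of_surjective L.mkQ L.mkQ_surjective
      (hG.pi (fun _ => Fin d → M) fun _ => hG.pi (fun _ => M) fun _ => genBy_self hM)
  · intro Y hY g
    have hF : ∀ j : Fin n, ∃ F : Fin d → (M →ₗ[R] Y),
        g (π (Pi.single j 1)) = ∑ i, F i (m i) := fun j =>
      mem_iSup_range_iff m hm _ (hY.2 ▸ Submodule.mem_top)
    choose F hF using hF
    let v : W →ₗ[R] Y := ∑ j, ∑ i, F j i ∘ₗ LinearMap.proj i ∘ₗ LinearMap.proj j
    have hv : v ∘ₗ u = g ∘ₗ π := by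
      refine LinearMap.pi_ext' fun j => LinearMap.ext_ring ?_
      change v (u (Pi.single j 1)) = g (π (Pi.single j 1))
      have hu : ∀ j' i, u (Pi.single j 1) j' i = (Pi.single j 1 : Fin n → R) j' • m i :=
        fun _ _ => rfl
      have hvw : ∀ w, v w = ∑ j, ∑ i, F j i (w j i) := fun w => by
        simp only [v, LinearMap.sum_apply]
        rfl
      rw [hF, hvw, Finset.sum_eq_single j]
      · simp [hu]
      · intro j' _ hj'
        simp [hu, Pi.single_eq_of_ne hj']
      · simp
    have hvL : L ≤ LinearMap.ker v := by
      rintro _ ⟨x, hx, rfl⟩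
      have := LinearMap.congr_fun hv x
      rw [LinearMap.comp_apply, LinearMap.comp_apply, LinearMap.mem_ker.mp hx, map_zero] at this
      exact this
    refine ⟨L.liftQ v hvL, fun x => ?_⟩
    obtain ⟨x, rfl⟩ := hπ x
    rw [hf]
    exact LinearMap.congr_fun hv x

end Generation

section Brick

variable {R : Type} [Ring R] {b : R} {M : Type} [AddCommGroup M] [Module R M]

/-- The sum of the images of the nilpotent endomorphisms of `M`. -/
def nilTrace (R M : Type) [Ring R] [AddCommGroup M] [Module R M] : Submodule R M :=
  ⨆ r : {r : Module.End R M // IsNilpotent r}, LinearMap.range r.1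

lemma FittingLocal.isLocalRing [Nontrivial M] (hL : FittingLocal R M) :
    IsLocalRing (Module.End R M) := by
  refine IsLocalRing.of_isUnit_or_isUnit_one_sub_self fun f => ?_
  rcases hL f with h | h
  · exact Or.inr h.isUnit_one_sub
  · exact Or.inl ((Module.End.isUnit_iff f).mpr h)

/-- A nonzero map out of a module with local endomorphism ring can be modified by an endomorphism
so as to stay nonzero but annihilate every nilpotent endomorphism. -/
lemma exists_comp_ne_zero_of_nilTrace_le (k : Type) [Field k] [Algebra k R] [Module k M]
    [IsScalarTower k R M] [Module.Finite k M] [Nontrivial M] (hL : FittingLocal R M)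
    {N : Type} [AddCommGroup N] [Module R N] (π : M →ₗ[R] N) (hπ : π ≠ 0) :
    ∃ e : M →ₗ[R] M, π ∘ₗ e ≠ 0 ∧ nilTrace R M ≤ LinearMap.ker (π ∘ₗ e) := by
  have := hL.isLocalRing
  have : SMulCommClass R k M := IsScalarTower.to_smulCommClass'
  have : IsArtinian R M := isArtinian_of_tower k inferInstance
  have hfin : Module.Finite k (Module.End R M) := by
    let ι : Module.End R M →ₗ[k] Module.End k M :=
      { toFun := fun f => f.restrictScalars k
        map_add' := fun _ _ => rfl
        map_smul' := fun _ _ => rfl }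
    exact Module.Finite.of_injective ι (LinearMap.restrictScalars_injective k)
  have : IsArtinianRing (Module.End R M) := IsArtinianRing.of_finite k _
  obtain ⟨n, hn⟩ := IsSemiprimaryRing.isNilpotent (R := Module.End R M)
  set J := Ring.jacobson (Module.End R M)
  have hex : ∃ n : ℕ, ∀ e ∈ J ^ n, π ∘ₗ e = 0 := ⟨n, fun e he => by
    rw [hn] at he
    have he : e = 0 := he
    rw [he, LinearMap.comp_zero]⟩
  classical
  have hspec := Nat.find_spec hex
  have hmin := fun m => Nat.find_min hex (m := m)
  obtain hzero | ⟨l, hl⟩ : Nat.find hex = 0 ∨ ∃ l, Nat.find hex = l + 1 := by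
    cases Nat.find hex <;> simp
  · rw [hzero, Submodule.pow_zero] at hspec
    exact absurd (hspec 1 (by rw [Ideal.one_eq_top]; exact Submodule.mem_top)) hπ
  · rw [hl] at hspec hmin
    have := hmin l (Nat.lt_succ_self l)
    push Not at this
    obtain ⟨e, he, hne⟩ := this
    refine ⟨e, hne, iSup_le ?_⟩
    rintro ⟨r, hr⟩ _ ⟨x, rfl⟩
    have hrJ : r ∈ J := by
      rw [show J = Ideal.jacobson ⊥ from Ideal.jacobson_bot.symm, Ideal.mem_jacobson_iff]
      intro y
      have hyr : IsNilpotent (y * r) := (hL (y * r)).resolve_right fun h =>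
        hr.not_isUnit ((Module.End.isUnit_iff r).mpr
          (IsArtinian.bijective_of_injective_endomorphism r (Function.Injective.of_comp h.1)))
      obtain ⟨z, hz⟩ := hyr.isUnit_one_add.exists_left_inv
      exact ⟨z, by rw [Ideal.mem_bot, sub_eq_zero, ← hz]; noncomm_ring⟩
    have := hspec (e * r) (by rw [Submodule.pow_succ]; exact Ideal.mul_mem_mul he hrJ)
    exact LinearMap.congr_fun this x

lemma IsTors.iSup [IsNoetherianRing R] {T : ModuleCat.{0} R → Prop} (hT : IsTors b T)
    (hM : BlockFG R b (ModuleCat.of R M)) {ι : Type*} (L : ι → Submodule R M)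
    (hL : ∀ i, T (ModuleCat.of R (L i))) : T (ModuleCat.of R (⨆ i, L i : Submodule R M)) := by
  set N : Submodule R M := ⨆ i, L i
  obtain ⟨t, ht, hmax⟩ := hT.exists_torsionPart
    (hM.of_injective N.subtype N.injective_subtype)
  refine hT.of_torsionPart_eq_top ht ?_
  have hle : N ≤ t.map N.subtype := iSup_le fun i => by
    have hi : L i ≤ N := le_iSup L i
    have h := hmax _ (hT.range (Submodule.inclusion hi) (hL i))
    intro x hx
    exact ⟨⟨x, hi hx⟩, h ⟨⟨x, hx⟩, rfl⟩, rfl⟩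
  rw [eq_top_iff]
  rintro ⟨x, hx⟩ _
  obtain ⟨y, hy, hyx⟩ := hle hx
  have : y = ⟨x, hx⟩ := Subtype.ext hyx
  exact this ▸ hy

section FiniteDimensional

variable (k : Type) [Field k] [Algebra k R] [Module k M] [IsScalarTower k R M] [Module.Finite k M]
  {T : ModuleCat.{0} R → Prop}

lemma nilTrace_ne_top (k : Type) [Field k] [Algebra k R] [Module k M]
    [IsScalarTower k R M] [Module.Finite k M] [Nontrivial M] (hL : FittingLocal R M) :
    nilTrace R M ≠ ⊤ := by
  intro h
  obtain ⟨e, he, hle⟩ := exists_comp_ne_zero_of_nilTrace_le k hL (LinearMap.id : M →ₗ[R] M)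
    (fun h0 => by
      obtain ⟨x, hx⟩ := exists_ne (0 : M)
      exact hx (LinearMap.congr_fun h0 x))
  rw [h, top_le_iff, LinearMap.ker_eq_top] at hle
  exact he hle

/-- The top of an Ext-projective module with local endomorphism ring is a brick. -/
lemma isBrickOver_quotient_nilTrace [IsAlgClosed k] [IsNoetherianRing R] [Nontrivial M]
    (hL : FittingLocal R M) (hT : IsTors b T) (hM : T (ModuleCat.of R M)) (hE : ExtProj T M) :
    IsBrickOver k R (M ⧸ nilTrace R M) := by
  refine ⟨Submodule.Quotient.nontrivial_iff.mpr (nilTrace_ne_top k hL), fun f => ?_⟩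
  have hK : T (ModuleCat.of R (nilTrace R M)) :=
    hT.iSup (hT.block hM) _ fun r => hT.range r.1 hM
  obtain ⟨g, hg⟩ := hE M (M ⧸ nilTrace R M) (nilTrace R M).mkQ (f ∘ₗ (nilTrace R M).mkQ) hM
    (Submodule.mkQ_surjective _) (by rw [Submodule.ker_mkQ]; exact hK)
  obtain ⟨c, hc⟩ := Module.End.exists_eigenvalue (g.restrictScalars k : Module.End k M)
  obtain ⟨x, hx⟩ := hc.exists_hasEigenvector
  have hsc : ∀ (r : R) (x : M), c • r • x = r • c • x := fun r x => by
    rw [← algebraMap_smul R c x, ← algebraMap_smul R c (r • x), ← mul_smul, ← mul_smul,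
      Algebra.commutes]
  let sc : M →ₗ[R] M :=
    { toFun := fun x => c • x
      map_add' := smul_add c
      map_smul' := hsc }
  have hnil : IsNilpotent (g - sc : Module.End R M) := by
    refine (hL _).resolve_right fun h => hx.2 (h.1 ?_)
    rw [map_zero]
    exact sub_eq_zero.mpr hx.apply_eq_smul
  refine ⟨c, fun u => ?_⟩
  obtain ⟨m, rfl⟩ := Submodule.mkQ_surjective _ u
  have h1 : f ((nilTrace R M).mkQ m) = (nilTrace R M).mkQ (g m) := (LinearMap.congr_fun hg m).symm
  have h2 : g m - c • m ∈ nilTrace R M :=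
    le_iSup (fun r : {r : Module.End R M // IsNilpotent r} => LinearMap.range r.1)
      ⟨_, hnil⟩ ⟨m, rfl⟩
  rw [h1, ← map_smul, ← sub_eq_zero, ← map_sub, algebraMap_smul, ← LinearMap.mem_ker,
    Submodule.ker_mkQ]
  exact h2

/-- A torsion class containing the top of `M` contains `M`. -/
lemma IsTors.of_quotient_nilTrace (k : Type) [Field k] [Algebra k R] [Module k M]
    [IsScalarTower k R M] [Module.Finite k M] [IsNoetherianRing R] [Nontrivial M]
    (hL : FittingLocal R M)
    (hM : BlockFG R b (ModuleCat.of R M)) (hT : IsTors b T)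
    (h : T (ModuleCat.of R (M ⧸ nilTrace R M))) : T (ModuleCat.of R M) := by
  obtain ⟨t, ht, hmax⟩ := hT.exists_torsionPart hM
  refine hT.of_torsionPart_eq_top ht ?_
  by_contra hne
  obtain ⟨e, he, hle⟩ := exists_comp_ne_zero_of_nilTrace_le k hL t.mkQ fun h0 => hne (by
    rw [← t.ker_mkQ, h0, LinearMap.ker_zero])
  have hI : T (ModuleCat.of R (LinearMap.range (t.mkQ ∘ₗ e))) := by
    have := hT.range ((nilTrace R M).liftQ (t.mkQ ∘ₗ e) hle) h
    rwa [Submodule.range_liftQ] at this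
  let N : Submodule R M := (LinearMap.range (t.mkQ ∘ₗ e)).comap t.mkQ
  have htN : t ≤ N := fun x hx => by
    have : t.mkQ x = 0 := (Submodule.Quotient.mk_eq_zero t).mpr hx
    rw [Submodule.mem_comap, this]
    exact Submodule.zero_mem _
  have hN : T (ModuleCat.of R N) := by
    refine hT.ext (Submodule.inclusion htN)
      ((t.mkQ ∘ₗ N.subtype).codRestrict (LinearMap.range (t.mkQ ∘ₗ e))
        fun x => Submodule.mem_comap.mp x.2) ?_ ?_
      (hM.of_injective N.subtype N.injective_subtype) ht hI
    · ext ⟨x, hx⟩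
      rw [LinearMap.mem_ker, Submodule.range_inclusion, Submodule.mem_comap, Subtype.ext_iff]
      exact Submodule.Quotient.mk_eq_zero t
    · rintro ⟨_, m, rfl⟩
      exact ⟨⟨e m, m, rfl⟩, rfl⟩
  refine he (LinearMap.ext fun m => ?_)
  exact (Submodule.Quotient.mk_eq_zero t).mpr (hmax N hN ⟨m, rfl⟩)

lemma torsCl_quotient_nilTrace (k : Type) [Field k] [Algebra k R] [Module k M]
    [IsScalarTower k R M] [Module.Finite k M] [IsNoetherianRing R] [Nontrivial M]
    (hL : FittingLocal R M) (hT : IsTors b T) (hM : T (ModuleCat.of R M)) (hE : ExtProj T M) :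
    TorsClIn R (BlockFG R b) (fun X => Nonempty (X ≃ₗ[R] (M ⧸ nilTrace R M))) = GenBy b M := by
  have hMb := hT.block hM
  funext Y
  refine propext ⟨fun hY => hY _ (isTors_genBy hT hM hE) ?_, fun hY T' hT' hC => ?_⟩
  · rintro X _ ⟨e⟩
    exact ((genBy_self hMb).of_surjective _ (Submodule.mkQ_surjective _)).of_surjective
      e.symm.toLinearMap e.symm.surjective
  · have hQ : T' (ModuleCat.of R (M ⧸ nilTrace R M)) :=
      hC _ (hMb.of_surjective _ (Submodule.mkQ_surjective _)) ⟨LinearEquiv.refl R _⟩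
    exact IsTors.of_genBy (N := Y) hT' (IsTors.of_quotient_nilTrace k hL hMb hT' hQ) hY

/-- The top of an Ext-projective module with local endomorphism ring is left finite. -/
lemma isLeftFiniteIn_quotient_nilTrace (k : Type) [Field k] [Algebra k R] [Module k M]
    [IsScalarTower k R M] [Module.Finite k M] [IsNoetherianRing R] [Nontrivial M]
    (hL : FittingLocal R M) (hT : IsTors b T) (hM : T (ModuleCat.of R M)) (hE : ExtProj T M) :
    IsLeftFiniteIn R (BlockFG R b) (M ⧸ nilTrace R M) := by
  rw [IsLeftFiniteIn, torsCl_quotient_nilTrace k hL hT hM hE]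
  have hG := isTors_genBy hT hM hE
  exact ⟨hG.contravariantlyFinite, genBy_covariantlyFinite k hG (hT.block hM)⟩

end FiniteDimensional

end Brick

section Twisting

variable {R : Type} [Ring R] {b : R}

/-- The module `M` with the action of `R` twisted by the automorphism `σ`. -/
def Twist (_ : R ≃+* R) (M : Type) : Type := M

namespace Twist

variable (σ : R ≃+* R) {M N : Type} [AddCommGroup M] [Module R M] [AddCommGroup N] [Module R N]

instance : AddCommGroup (Twist σ M) := inferInstanceAs (AddCommGroup M)

instance : Module R (Twist σ M) := Module.compHom M (σ : R →+* R)

/-- The identity map, from the twisted module to the untwisted one. -/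
def out : Twist σ M ≃+ M := AddEquiv.refl M

lemma out_smul (a : R) (u : Twist σ M) : out σ (a • u) = σ a • out σ u := rfl

lemma symm_smul (a : R) (u : M) : (out σ).symm (σ a • u) = a • (out σ).symm u := rfl

/-- Twisting as a functor. -/
def map (f : M →ₗ[R] N) : Twist σ M →ₗ[R] Twist σ N where
  toFun u := (out σ).symm (f (out σ u))
  map_add' u v := by rw [map_add, map_add, map_add]
  map_smul' a u := by rw [out_smul, map_smul, symm_smul, RingHom.id_apply]

lemma map_surjective {f : M →ₗ[R] N} (hf : Function.Surjective f) :
    Function.Surjective (map σ f) := hf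

lemma blockFG (hσb : σ b = b) (h : BlockFG R b (ModuleCat.of R M)) :
    BlockFG R b (ModuleCat.of R (Twist σ M)) := by
  obtain ⟨h1, h2⟩ := h
  have : Module.Finite R M := h1
  let f : M →ₛₗ[(σ.symm : R →+* R)] Twist σ M :=
    { toFun := (out σ).symm
      map_add' := map_add _
      map_smul' := fun a u => (congrArg (fun r : R => (out σ).symm (r • u))
        (σ.apply_symm_apply a).symm).trans (symm_smul σ _ u) }
  have : RingHomSurjective (σ.symm : R →+* R) := ⟨σ.symm.surjective⟩
  refine ⟨Module.Finite.of_surjective f (out σ).symm.surjective, fun u => ?_⟩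
  have h3 : ∀ m : M, σ b • m = m := by rw [hσb]; exact h2
  exact h3 (out σ u)

lemma blockFG_of (hσb : σ b = b) (h : BlockFG R b (ModuleCat.of R (Twist σ M))) :
    BlockFG R b (ModuleCat.of R M) := by
  obtain ⟨h1, h2⟩ := h
  have : Module.Finite R (Twist σ M) := h1
  let f : Twist σ M →ₛₗ[(σ : R →+* R)] M :=
    { toFun := out σ
      map_add' := map_add _
      map_smul' := out_smul σ }
  have : RingHomSurjective (σ : R →+* R) := ⟨σ.surjective⟩
  refine ⟨Module.Finite.of_surjective f (out σ).surjective, fun u => ?_⟩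
  have h3 : σ b • u = u := h2 ((out σ).symm u)
  rwa [hσb] at h3

/-- The modules whose twist lies in a torsion class form a torsion class. -/
lemma isTors (hσb : σ b = b) {T : ModuleCat.{0} R → Prop} (hT : IsTors b T) :
    IsTors b (fun Y => T (ModuleCat.of R (Twist σ Y))) := by
  refine ⟨fun M h => blockFG_of (M := M) σ hσb (hT.block h), ?_, ?_, ?_⟩
  · intro M N f _ hf h
    exact hT.of_surjective (map (M := M) (N := N) σ f) hf h
  · intro n N h _
    let f : ((i : Fin n) → Twist σ (N i)) →ₗ[R] Twist σ ((i : Fin n) → N i) :=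
      { toFun := fun u => (out σ).symm fun i => out σ (u i)
        map_add' := fun _ _ => rfl
        map_smul' := fun _ _ => rfl }
    exact hT.of_surjective f (fun u => ⟨fun i => (out σ).symm (out σ u i), rfl⟩)
      (hT.pi (fun i => Twist σ (N i)) h)
  · intro M A hM hA hC
    refine hT.ext (map σ A.subtype) (map σ A.mkQ) ?_ (map_surjective σ A.mkQ_surjective)
      (blockFG (M := M) σ hσb hM) hA hC
    ext x
    constructor
    · intro h
      exact ⟨⟨x, (Submodule.Quotient.mk_eq_zero A).mp h⟩, rfl⟩
    · rintro ⟨y, rfl⟩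
      exact (Submodule.Quotient.mk_eq_zero A).mpr y.2

end Twist

section FiniteDimensional

variable {k : Type} [Field k] [Algebra k R] {M N : Type} [AddCommGroup M] [Module R M]
  [Module k M] [IsScalarTower k R M] [Module.Finite k M]

lemma Twist.bijective_of_surjective {σ : R ≃+* R}
    (hσ : ∀ c : k, σ (algebraMap k R c) = algebraMap k R c)
    (f : Twist σ M →ₗ[R] M) (hf : Function.Surjective f) : Function.Bijective f := by
  let φ : M →ₗ[k] M :=
    { toFun := fun u => f ((out σ).symm u)
      map_add' := fun u v => by rw [map_add, map_add]
      map_smul' := fun c u => by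
        rw [RingHom.id_apply, ← algebraMap_smul R c u, ← algebraMap_smul R c (f _), ← hσ c,
          symm_smul, map_smul, hσ c] }
  exact ⟨(LinearMap.injective_iff_surjective (f := φ)).mpr hf, hf⟩

/-- An Ext-projective module with local endomorphism ring is stable if its top is. -/
lemma nonempty_twist_equiv_of_quotient_nilTrace [IsAlgClosed k] [IsNoetherianRing R] [Nontrivial M]
    {σ : R ≃+* R}
    (hσ : ∀ c : k, σ (algebraMap k R c) = algebraMap k R c) (hσb : σ b = b)
    {T : ModuleCat.{0} R → Prop} (hL : FittingLocal R M) (hT : IsTors b T)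
    (hM : T (ModuleCat.of R M)) (hE : ExtProj T M)
    (h₁ : Nonempty (Twist σ (M ⧸ nilTrace R M) ≃ₗ[R] (M ⧸ nilTrace R M)))
    (h₂ : Nonempty (Twist σ.symm (M ⧸ nilTrace R M) ≃ₗ[R] (M ⧸ nilTrace R M))) :
    Nonempty (Twist σ M ≃ₗ[R] M) := by
  have hMb := hT.block hM
  have hG := isTors_genBy hT hM hE
  have hQ : GenBy b M (ModuleCat.of R (M ⧸ nilTrace R M)) :=
    (genBy_self hMb).of_surjective _ (Submodule.mkQ_surjective _)
  have key : ∀ s : R ≃+* R, s b = b →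
      Nonempty (Twist s (M ⧸ nilTrace R M) ≃ₗ[R] (M ⧸ nilTrace R M)) →
      GenBy b M (ModuleCat.of R (Twist s M)) := by
    rintro s hs ⟨ψ⟩
    exact IsTors.of_quotient_nilTrace (T := fun Y => GenBy b M (ModuleCat.of R (Twist s Y))) k hL
      hMb (Twist.isTors s hs hG)
      (GenBy.of_surjective (N := M ⧸ nilTrace R M) ψ.symm.toLinearMap ψ.symm.surjective hQ)
  have k₁ := (key σ hσb h₁).2
  have k₂ := (key σ.symm ((RingEquiv.symm_apply_eq σ).mpr hσb.symm) h₂).2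
  let G : (M →ₗ[R] Twist σ.symm M) → (Twist σ M →ₗ[R] M) := fun g =>
    { toFun := fun u => Twist.out σ.symm (g (Twist.out σ u))
      map_add' := fun u v => by rw [map_add, map_add, map_add]
      map_smul' := fun a u => by
        rw [Twist.out_smul, map_smul, Twist.out_smul, RingEquiv.symm_apply_apply,
          RingHom.id_apply] }
  by_cases hnil : ∀ (f : M →ₗ[R] Twist σ M) (g : M →ₗ[R] Twist σ.symm M),
      IsNilpotent (G g ∘ₗ f : Module.End R M)
  · refine absurd ?_ (nilTrace_ne_top k hL)
    have h3 : ∀ g, LinearMap.range (G g) ≤ nilTrace R M := by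
      intro g
      rw [LinearMap.range_eq_map]
      refine (Submodule.map_mono k₁.ge).trans ?_
      rw [Submodule.map_iSup]
      refine iSup_le fun f => ?_
      rw [← LinearMap.range_comp]
      exact le_iSup (fun r : {r : Module.End R M // IsNilpotent r} => LinearMap.range r.1)
        ⟨_, hnil f g⟩
    rw [eq_top_iff]
    intro m _
    have h4 : (⨆ g : M →ₗ[R] Twist σ.symm M, LinearMap.range g) ≤
        LinearMap.range (Twist.map σ.symm (nilTrace R M).subtype) := by
      refine iSup_le fun g => ?_
      rintro _ ⟨u, rfl⟩
      exact ⟨⟨g u, h3 g ⟨u, rfl⟩⟩, rfl⟩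
    have h5 : (Twist.out σ.symm).symm m ∈ ⨆ g : M →ₗ[R] Twist σ.symm M, LinearMap.range g := by
      rw [show (⨆ g : M →ₗ[R] Twist σ.symm M, LinearMap.range g) = ⊤ from k₂]
      exact Submodule.mem_top
    obtain ⟨x, hx⟩ := h4 h5
    exact (show x.1 = m from hx) ▸ x.2
  · push Not at hnil
    obtain ⟨f, g, h⟩ := hnil
    have hfg := (hL _).resolve_left h
    have hg : Function.Surjective (G g) := fun y => by
      obtain ⟨x, hx⟩ := hfg.2 y
      exact ⟨f x, hx⟩
    exact ⟨LinearEquiv.ofBijective _ (Twist.bijective_of_surjective hσ _ hg)⟩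

end FiniteDimensional

/-- If left finite bricks are stable under `σ`, so are the summands of left finite semibricks. -/
lemma nonempty_twist_equiv_of_semibrick {k : Type} [Field k] [IsAlgClosed k] [Algebra k R]
    [Module.Finite k R] (hb : IsCentralIdem R b) {σ : R ≃+* R}
    (hσ : ∀ c : k, σ (algebraMap k R c) = algebraMap k R c) (hσb : σ b = b)
    (hst : ∀ U : BModule k R, Module.Finite R U → LiesIn R b U → IsBrickOver k R U →
      IsLeftFiniteIn R (BlockFG R b) U →
      Nonempty (Twist σ U ≃ₗ[R] U) ∧ Nonempty (Twist σ.symm U ≃ₗ[R] U))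
    {n : ℕ} (S : Fin n → BModule k R) [∀ i, Module.Finite R (S i)]
    [∀ i, Nontrivial (S i)] (hblock : ∀ i, LiesIn R b (S i))
    (hS : ∀ i j (f : S i →ₗ[R] S j), f = 0 ∨ Function.Bijective f)
    (hLF : IsLeftFiniteIn R (BlockFG R b) ((i : Fin n) → S i)) (i : Fin n) :
    Nonempty (Twist σ (S i) ≃ₗ[R] S i) := by
  have : IsArtinianRing R := IsArtinianRing.of_finite k R
  set T := TorsClIn R (BlockFG R b) (fun X => Nonempty (X ≃ₗ[R] ((i : Fin n) → S i))) with hTdef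
  have hT : IsTors b T := isTors_torsClIn
  have hPib : BlockFG R b (ModuleCat.of R ((i : Fin n) → S i)) :=
    BlockFG.pi (fun i => S i) fun i => ⟨inferInstance, hblock i⟩
  have hPi : T (ModuleCat.of R ((i : Fin n) → S i)) := by
    intro T' hT' hC
    exact hC _ hPib ⟨LinearEquiv.refl R _⟩
  have hST : ∀ j, T (ModuleCat.of R (S j)) := fun j =>
    hT.of_surjective (LinearMap.proj j) (LinearMap.proj_surjective j) hPi
  have hker : ∀ j (Y : Type) [AddCommGroup Y] [Module R Y] (f : Y →ₗ[R] S j),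
      T (ModuleCat.of R Y) → f = 0 ∨ Function.Surjective f ∧ T (ModuleCat.of R (LinearMap.ker f)) :=
    fun j Y _ _ f hY => eq_zero_or_surjective_of_torsCl hS hY j f
  have cover : ∀ j, ∃ M : ModuleCat.{0} R, T M ∧ ExtProj T M ∧ FittingLocal R M ∧
      Nonempty (Twist σ M ≃ₗ[R] M) ∧ ∃ q : M →ₗ[R] S j, q ≠ 0 := by
    intro j
    obtain ⟨M, hM, hE, hL, q, hq⟩ := exists_extProj_cover hb hT hLF.2 (hST j)
    refine ⟨M, hM, hE, hL, ?_, q, hq⟩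
    let _ : Module k M := Module.compHom M (algebraMap k R)
    have : IsScalarTower k R M := ⟨fun c r m => by
      rw [Algebra.smul_def, mul_smul]
      rfl⟩
    have hMb : BlockFG R b M := hT.1 _ hM
    have : Module.Finite R M := hMb.1
    have : Module.Finite k M := Module.Finite.trans R M
    have : Nontrivial M := by
      by_contra h
      rw [not_nontrivial_iff_subsingleton] at h
      exact hq (LinearMap.ext fun m => by rw [Subsingleton.elim m 0, map_zero, map_zero])
    have hQb : BlockFG R b (ModuleCat.of R (M ⧸ nilTrace R M)) :=
      BlockFG.of_surjective (M := M) _ (Submodule.mkQ_surjective _) hMb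
    obtain ⟨h₁, h₂⟩ :=
      hst ⟨M ⧸ nilTrace R M⟩ hQb.1 hQb.2 (isBrickOver_quotient_nilTrace k hL hT hM hE)
      (isLeftFiniteIn_quotient_nilTrace k hL hT hM hE)
    exact nonempty_twist_equiv_of_quotient_nilTrace hσ hσb hL hT hM hE h₁ h₂
  have htw : ∀ Y : ModuleCat.{0} R, T Y → T (ModuleCat.of R (Twist σ Y)) := by
    have hPi' : T (ModuleCat.of R (Twist σ ((i : Fin n) → S i))) := by
      refine (Twist.isTors σ hσb hT).pi (fun j => S j) fun j => ?_
      obtain ⟨M, hM, -, -, ⟨θ⟩, q, hq⟩ := cover j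
      exact hT.of_surjective (Twist.map σ q ∘ₗ θ.symm.toLinearMap)
        ((Twist.map_surjective σ ((hker j M q hM).resolve_left hq).1).comp θ.symm.surjective) hM
    intro Y hY
    refine hY _ (Twist.isTors σ hσb hT) ?_
    rintro X _ ⟨e⟩
    exact hT.of_surjective (Twist.map σ e.symm.toLinearMap)
      (Twist.map_surjective σ e.symm.surjective) hPi'
  obtain ⟨M, hM, hE, hL, ⟨θ⟩, q, hq⟩ := cover i
  obtain ⟨hqs, hK⟩ := (hker i M q hM).resolve_left hq
  let κ : Twist σ (LinearMap.ker q) →ₗ[R] M :=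
    θ.toLinearMap ∘ₗ Twist.map σ (LinearMap.ker q).subtype
  have hκ : LinearMap.range κ ≤ LinearMap.ker q := by
    refine le_ker_of_extProj hE hL (hker i) q hq _ (hT.range κ (htw _ hK)) fun htop => hq ?_
    ext m
    obtain ⟨x, hx⟩ := LinearMap.range_eq_top.mp htop (θ ((Twist.out σ).symm m))
    have hx' := θ.injective hx
    exact (show (x : LinearMap.ker q).1 = m from hx') ▸ (show (x : LinearMap.ker q).1 ∈ _ from
      Subtype.property (p := fun y => y ∈ LinearMap.ker q) x)
  have hwd : ∀ m m' : M, q m = q m' →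
      q (θ ((Twist.out σ).symm m)) = q (θ ((Twist.out σ).symm m')) := by
    intro m m' h
    rw [← sub_eq_zero, ← map_sub, ← map_sub, ← map_sub]
    exact hκ ⟨⟨m - m', by rw [LinearMap.mem_ker, map_sub, h, sub_self]⟩, rfl⟩
  have hr := Function.surjInv_eq hqs
  let ψ : Twist σ (S i) →ₗ[R] S i :=
    { toFun := fun u => q (θ ((Twist.out σ).symm (Function.surjInv hqs (Twist.out σ u))))
      map_add' := fun u v => by
        rw [← map_add, ← map_add, ← map_add]
        refine hwd _ _ ?_
        rw [map_add, map_add, hr, hr, hr]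
      map_smul' := fun a u => by
        rw [RingHom.id_apply, ← map_smul q, ← map_smul θ, ← Twist.symm_smul]
        refine hwd _ _ ?_
        rw [hr, map_smul q, hr, Twist.out_smul] }
  have hψ : Function.Surjective ψ := fun s => by
    obtain ⟨m, rfl⟩ := hqs s
    obtain ⟨u, rfl⟩ := θ.surjective m
    exact ⟨(Twist.out σ).symm (q (Twist.out σ u)), hwd _ _ (hr _)⟩
  have : Module.Finite k (S i) := Module.Finite.trans R (S i)
  exact ⟨LinearEquiv.ofBijective _ (Twist.bijective_of_surjective hσ ψ hψ)⟩

end Twisting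

section Cocycle

variable {k I L : Type} [Field k] [Group I] [Group L] {H : Subgroup I} {ρ : H →* L} {z : kˣ →* L}

/-- A stable homomorphism on a normal subgroup whose centralizer consists of scalars extends when
the second cohomology group of the quotient vanishes. -/
lemma exists_extension_of_h2Trivial [H.Normal] (hz : Function.Injective z)
    (hcomm : ∀ c l, z c * l = l * z c)
    (hC : ∀ l, (∀ h, l * ρ h = ρ h * l) → ∃ c, l = z c)
    (hst : ∀ x : I, ∃ l : L, ∀ h h' : H, (h' : I) = x⁻¹ * h * x → l * ρ h' = ρ h * l)
    (hH2 : H2Trivial k (I ⧸ H)) :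
    ∃ ρ' : I →* L, ∀ h : H, ρ' h = ρ h := by
  choose l hl using hst
  let t : I → I := fun x => Quotient.out (x : I ⧸ H)
  have ht : ∀ x, (t x)⁻¹ * x ∈ H := fun x => QuotientGroup.eq.mp (Quotient.out_eq (x : I ⧸ H))
  have htg : ∀ x (g : H), t (x * g) = t x := fun x g =>
    congrArg Quotient.out (QuotientGroup.mk_mul_of_mem x g.2)
  obtain ⟨P, hPmul, hPconj⟩ : ∃ P : I → L, (∀ x (g : H), P (x * g) = P x * ρ g) ∧
      ∀ x (h h' : H), (h' : I) = x⁻¹ * h * x → P x * ρ h' = ρ h * P x := by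
    refine ⟨fun x => l (t x) * ρ ⟨(t x)⁻¹ * x, ht x⟩, fun x g => ?_, fun x h h' hh => ?_⟩
    · have h1 : (⟨(t (x * g))⁻¹ * (x * g), ht _⟩ : H) = ⟨(t x)⁻¹ * x, ht x⟩ * g :=
        Subtype.ext ((congrArg (fun y => y⁻¹ * (x * g)) (htg x g)).trans (mul_assoc _ _ _).symm)
      dsimp only
      rw [h1, htg, map_mul, ← mul_assoc]
    · set g : H := ⟨(t x)⁻¹ * x, ht x⟩ with hg
      have h1 : l (t x) * ρ (g * h' * g⁻¹) = ρ h * l (t x) := hl _ _ _ (by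
        rw [Subgroup.coe_mul, Subgroup.coe_mul, Subgroup.coe_inv, hh, hg]
        group)
      calc l (t x) * ρ g * ρ h' = l (t x) * ρ (g * h' * g⁻¹) * ρ g := by
            rw [map_mul, map_mul, map_inv]
            group
        _ = ρ h * (l (t x) * ρ g) := by rw [h1, mul_assoc]
  have hα : ∀ x y, ∃ c, P x * P y = z c * P (x * y) := by
    intro x y
    obtain ⟨c, hc⟩ := hC (P x * P y * (P (x * y))⁻¹) fun h => by
      have n1 : (x * y)⁻¹ * h * (x * y) ∈ H := by
        have := ‹H.Normal›.conj_mem h h.2 (x * y)⁻¹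
        rwa [inv_inv] at this
      have n2 : x⁻¹ * h * x ∈ H := by
        have := ‹H.Normal›.conj_mem h h.2 x⁻¹
        rwa [inv_inv] at this
      have e1 := hPconj (x * y) h ⟨_, n1⟩ rfl
      have e2 := hPconj x h ⟨_, n2⟩ rfl
      have e3 := hPconj y ⟨_, n2⟩ ⟨_, n1⟩ (by
        simp only
        group)
      have e4 : (P (x * y))⁻¹ * ρ h = ρ ⟨_, n1⟩ * (P (x * y))⁻¹ := by
        rw [inv_mul_eq_iff_eq_mul, ← mul_assoc, e1, mul_inv_cancel_right]
      rw [mul_assoc, e4, ← mul_assoc, mul_assoc (P x), e3, ← mul_assoc, e2]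
      group
    exact ⟨c, by rw [← hc, inv_mul_cancel_right]⟩
  choose a ha using hα
  have hinj : ∀ {c d : kˣ} {u : L}, z c * u = z d * u → c = d := fun h => hz (mul_right_cancel h)
  have ha₁ : ∀ x y (g : H), a (x * g) y = a x y := by
    intro x y g
    have n1 : y⁻¹ * g * y ∈ H := by
      have := ‹H.Normal›.conj_mem g g.2 y⁻¹
      rwa [inv_inv] at this
    have e1 := hPconj y g ⟨_, n1⟩ rfl
    have e2 := hPmul (x * y) ⟨_, n1⟩
    have e3 : x * y * (y⁻¹ * g * y) = x * g * y := by group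
    simp only [e3] at e2
    refine hinj (u := P (x * g * y)) ?_
    rw [← ha, hPmul, mul_assoc, ← e1, ← mul_assoc, ha, e2, mul_assoc]
  have ha₂ : ∀ x y (g : H), a x (y * g) = a x y := by
    intro x y g
    refine hinj (u := P (x * (y * g))) ?_
    rw [← ha, hPmul, ← mul_assoc, ha, ← mul_assoc, hPmul, mul_assoc]
  let α : I ⧸ H → I ⧸ H → kˣ := fun q r => a q.out r.out
  have haα : ∀ x y : I, a x y = α x y := by
    intro x y
    have e : ∀ x : I, x = Quotient.out (x : I ⧸ H) * (⟨(t x)⁻¹ * x, ht x⟩ : H) := fun x =>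
      (mul_inv_cancel_left (t x) x).symm
    conv_lhs => rw [e x, e y]
    rw [ha₁, ha₂]
  obtain ⟨β, hβ⟩ := hH2 α (by
    intro q r s
    induction q using QuotientGroup.induction_on with | H x => ?_
    induction r using QuotientGroup.induction_on with | H y => ?_
    induction s using QuotientGroup.induction_on with | H w => ?_
    rw [← QuotientGroup.mk_mul, ← QuotientGroup.mk_mul, ← haα, ← haα, ← haα, ← haα]
    refine hinj (u := P (x * y * w)) ?_
    calc z (a x y * a (x * y) w) * P (x * y * w) = P x * P y * P w := by
          rw [map_mul, mul_assoc, ← ha, ← mul_assoc, ← ha]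
      _ = z (a y w * a x (y * w)) * P (x * y * w) := by
          rw [mul_assoc, ha y, ← mul_assoc, ← hcomm, mul_assoc, ha, ← mul_assoc, ← map_mul,
            mul_assoc x])
  let ρ' : I →* L := MonoidHom.mk' (fun x => z (β x)⁻¹ * P x) fun x y => by
    calc z (β ↑(x * y))⁻¹ * P (x * y) = z ((β x)⁻¹ * (β y)⁻¹ * a x y) * P (x * y) := by
          rw [haα, hβ, QuotientGroup.mk_mul, mul_assoc, mul_assoc (β x),
            mul_left_comm (β y)⁻¹, inv_mul_cancel_left, inv_mul_cancel_left]
      _ = z (β x)⁻¹ * P x * (z (β y)⁻¹ * P y) := by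
          rw [map_mul, map_mul, mul_assoc, ← ha, mul_assoc, mul_assoc, ← mul_assoc (P x),
            ← hcomm _ (P x), mul_assoc]
  refine ⟨ρ', fun h => ?_⟩
  have h1 : ρ' h = ρ' 1 * ρ h := by
    change z (β (h : I))⁻¹ * P h = z (β ((1 : I) : I ⧸ H))⁻¹ * P 1 * ρ h
    rw [mul_assoc, ← hPmul, one_mul, (QuotientGroup.eq_one_iff (h : I)).mpr h.2]
    rfl
  rw [h1, map_one, one_mul]

/-- Two extensions of a homomorphism whose centralizer consists of scalars differ by a linear
character of the quotient. -/
lemma exists_character_of_extensions [H.Normal] (hz : Function.Injective z)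
    (hcomm : ∀ c l, z c * l = l * z c)
    (hC : ∀ l, (∀ h, l * ρ h = ρ h * l) → ∃ c, l = z c)
    (ρ₁ ρ₂ : I →* L) (h₁ : ∀ h : H, ρ₁ h = ρ h) (h₂ : ∀ h : H, ρ₂ h = ρ h) :
    ∃ χ : I ⧸ H →* kˣ, ∀ x : I, ρ₁ x = z (χ x) * ρ₂ x := by
  have hx : ∀ x, ∃ c, ρ₁ x * (ρ₂ x)⁻¹ = z c := fun x => hC _ fun h => by
    have n : x⁻¹ * h * x ∈ H := by
      have := ‹H.Normal›.conj_mem h h.2 x⁻¹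
      rwa [inv_inv] at this
    have e₁ : ρ₁ x * ρ ⟨_, n⟩ = ρ h * ρ₁ x := by
      rw [← h₁, ← h₁, ← map_mul, ← map_mul]
      exact congrArg ρ₁ (by simp only; group)
    have e₂ : ρ ⟨_, n⟩ * (ρ₂ x)⁻¹ = (ρ₂ x)⁻¹ * ρ h := by
      rw [← h₂, ← h₂, ← map_inv, ← map_mul, ← map_mul]
      exact congrArg ρ₂ (by simp only; group)
    rw [mul_assoc, ← e₂, ← mul_assoc, e₁, mul_assoc]
  choose c hc using hx
  let γ : I →* kˣ := MonoidHom.mk' c fun x y => hz (by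
    calc z (c (x * y)) = ρ₁ x * (ρ₁ y * (ρ₂ y)⁻¹) * (ρ₂ x)⁻¹ := by
          rw [← hc, map_mul, map_mul]
          group
      _ = z (c x * c y) := by
          rw [hc y, ← hcomm, mul_assoc, hc, ← map_mul, mul_comm])
  refine ⟨QuotientGroup.lift H γ fun h hh => hz ?_, fun x => ?_⟩
  · have := hc h
    rw [h₁ ⟨h, hh⟩, h₂ ⟨h, hh⟩, mul_inv_cancel] at this
    rw [map_one]
    exact this.symm
  · change ρ₁ x = z (c x) * ρ₂ x
    rw [← hc, inv_mul_cancel_right]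

end Cocycle

section Representations

variable (k : Type) [Field k] {A B : Type} [Group A] [Group B]

lemma mapAlong_of (f : A →* B) (a : A) :
    MapAlong k f (MonoidAlgebra.of k A a) = MonoidAlgebra.of k B (f a) :=
  MonoidAlgebra.mapDomain_single

lemma mapAlong_algebraMap (f : A →* B) (c : k) :
    MapAlong k f (algebraMap k (MonoidAlgebra k A) c) = algebraMap k (MonoidAlgebra k B) c :=
  MonoidAlgebra.mapDomain_algebraMap k f c

/-- The representation of `A` on a `k[A]`-module. -/
noncomputable def repOf (A : Type) [Group A] (V : Type) [AddCommGroup V] [Module k V]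
    [Module (MonoidAlgebra k A) V] [IsScalarTower k (MonoidAlgebra k A) V] :
    A →* (Module.End k V)ˣ :=
  MonoidHom.toHomUnits
    (((Algebra.lsmul k k V : MonoidAlgebra k A →ₐ[k] Module.End k V) :
      MonoidAlgebra k A →* Module.End k V).comp (MonoidAlgebra.of k A))

/-- The scalar automorphisms. -/
def scalarUnits (V : Type) [AddCommGroup V] [Module k V] : kˣ →* (Module.End k V)ˣ :=
  Units.map (algebraMap k (Module.End k V) : k →* Module.End k V)

variable {k}

/-- The `k[A]`-module given by a representation. -/
noncomputable def ofRep {V : Type} [AddCommGroup V] [Module k V] (ρ : A →* (Module.End k V)ˣ) :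
    BModule k (MonoidAlgebra k A) :=
  let F : MonoidAlgebra k A →ₐ[k] Module.End k V :=
    MonoidAlgebra.lift k (Module.End k V) A ((Units.coeHom _).comp ρ)
  letI : Module (MonoidAlgebra k A) V := Module.compHom V (F : MonoidAlgebra k A →+* Module.End k V)
  { carrier := V
    isTower := ⟨fun c r v => LinearMap.congr_fun (map_smul F c r) v⟩ }

lemma ofRep_smul {V : Type} [AddCommGroup V] [Module k V] (ρ : A →* (Module.End k V)ˣ) (a : A)
    (v : ofRep ρ) :
    MonoidAlgebra.of k A a • v = (ρ a : Module.End k V) v :=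
  LinearMap.congr_fun (MonoidAlgebra.lift_of ((Units.coeHom _).comp ρ) a) v

lemma scalarUnits_injective {V : Type} [AddCommGroup V] [Module k V] [Nontrivial V] :
    Function.Injective (scalarUnits k V) :=
  Units.map_injective (FaithfulSMul.algebraMap_injective k (Module.End k V))

lemma scalarUnits_mul_comm {V : Type} [AddCommGroup V] [Module k V] (c : kˣ)
    (l : (Module.End k V)ˣ) : scalarUnits k V c * l = l * scalarUnits k V c :=
  Units.ext (Algebra.commutes (c : k) (l : Module.End k V))

/-- An extension of a brick is a brick. -/
lemma ExtendsAlong.isBrickOver {U : Type} [AddCommGroup U] [Module (MonoidAlgebra k A) U]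
    {W : Type} [AddCommGroup W] [Module (MonoidAlgebra k B) W] {f : A →* B}
    (h : ExtendsAlong k f U W) (hU : IsBrickOver k (MonoidAlgebra k A) U) :
    IsBrickOver k (MonoidAlgebra k B) W := by
  obtain ⟨φ, hφ⟩ := h
  have := hU.1
  refine ⟨φ.symm.toEquiv.nontrivial, fun g => ?_⟩
  obtain ⟨c, hc⟩ := hU.2
    { toFun := fun u => φ.symm (g (φ u))
      map_add' := fun u v => by rw [map_add, map_add, map_add]
      map_smul' := fun a u => by
        rw [hφ, map_smul, RingHom.id_apply, AddEquiv.symm_apply_eq, hφ,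
          AddEquiv.apply_symm_apply] }
  refine ⟨c, fun w => ?_⟩
  obtain ⟨u, rfl⟩ := φ.surjective w
  rw [← mapAlong_algebraMap k f, ← hφ, ← hc]
  exact (φ.apply_symm_apply _).symm

variable {U : Type} [AddCommGroup U] [Module k U] [Module (MonoidAlgebra k A) U]
  [IsScalarTower k (MonoidAlgebra k A) U]
  {W : Type} [AddCommGroup W] [Module k W] [Module (MonoidAlgebra k B) W]
  [IsScalarTower k (MonoidAlgebra k B) W]

lemma map_smul_mapAlong (f : A →* B) (φ : U →ₗ[k] W)
    (h : ∀ a u, φ (MonoidAlgebra.of k A a • u) = MonoidAlgebra.of k B (f a) • φ u)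
    (r : MonoidAlgebra k A) (u : U) : φ (r • u) = MapAlong k f r • φ u := by
  induction r using MonoidAlgebra.induction_on generalizing u with
  | of a => rw [h, mapAlong_of]
  | add r s hr hs => rw [add_smul, map_add, hr, hs, map_add, add_smul]
  | smul c r hr =>
    rw [smul_assoc, map_smul, hr, Algebra.smul_def, map_mul, mapAlong_algebraMap, mul_smul,
      algebraMap_smul]

lemma extendsAlong_iff (f : A →* B) :
    ExtendsAlong k f U W ↔ ∃ φ : U ≃ₗ[k] W, ∀ a u,
      φ (MonoidAlgebra.of k A a • u) = MonoidAlgebra.of k B (f a) • φ u := by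
  constructor
  · rintro ⟨φ, hφ⟩
    refine ⟨{ φ with map_smul' := fun c u => ?_ }, fun a u => ?_⟩
    · change φ (c • u) = c • φ u
      rw [← algebraMap_smul (MonoidAlgebra k A) c u, hφ, mapAlong_algebraMap, algebraMap_smul]
    · change φ _ = _ • φ u
      rw [hφ, mapAlong_of]
  · rintro ⟨φ, hφ⟩
    exact ⟨φ.toAddEquiv, fun r u => map_smul_mapAlong f φ.toLinearMap hφ r u⟩

variable {W' : Type} [AddCommGroup W'] [Module k W'] [Module (MonoidAlgebra k A) W']
  [IsScalarTower k (MonoidAlgebra k A) W']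

lemma nonempty_linearEquiv_iff :
    Nonempty (U ≃ₗ[MonoidAlgebra k A] W') ↔ ∃ φ : U ≃ₗ[k] W', ∀ a u,
      φ (MonoidAlgebra.of k A a • u) = MonoidAlgebra.of k A a • φ u := by
  constructor
  · rintro ⟨φ⟩
    exact ⟨φ.restrictScalars k, fun a u => map_smul φ _ _⟩
  · rintro ⟨φ, hφ⟩
    refine ⟨{ φ with map_smul' := fun r u => ?_ }⟩
    induction r using MonoidAlgebra.induction_on generalizing u with
    | of a => exact hφ a u
    | add r s hr hs =>
      have hr' : φ (r • u) = r • φ u := hr u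
      have hs' : φ (s • u) = s • φ u := hs u
      change φ ((r + s) • u) = (r + s) • φ u
      rw [add_smul, map_add, hr', hs', add_smul]
    | smul c r hr =>
      have hr' : φ (r • u) = r • φ u := hr u
      change φ ((c • r) • u) = (c • r) • φ u
      rw [smul_assoc, map_smul, hr', smul_assoc]

/-- The automorphisms of the underlying space commuting with a brick are scalars. -/
lemma IsBrickOver.exists_eq_scalarUnits (hU : IsBrickOver k (MonoidAlgebra k A) U)
    (l : (Module.End k U)ˣ) (hl : ∀ a, l * repOf k A U a = repOf k A U a * l) :
    ∃ c, l = scalarUnits k U c := by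
  have hl' : ∀ a (u : U), (l : Module.End k U) (MonoidAlgebra.of k A a • u) =
      MonoidAlgebra.of k A a • (l : Module.End k U) u := fun a u =>
    LinearMap.congr_fun (congrArg Units.val (hl a)) u
  obtain ⟨c, hc⟩ := hU.2 (MonoidAlgebra.equivariantOfLinearOfComm (l : Module.End k U) hl')
  have hc' : ∀ u, (l : Module.End k U) u = c • u := fun u =>
    (hc u).trans (algebraMap_smul _ c u)
  have hc0 : c ≠ 0 := by
    rintro rfl
    obtain ⟨u, hu⟩ := @exists_ne U hU.1 0
    have h1 := LinearMap.congr_fun l.inv_mul u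
    rw [Module.End.mul_apply, hc', zero_smul, map_zero] at h1
    exact hu h1.symm
  exact ⟨Units.mk0 c hc0, Units.ext (LinearMap.ext hc')⟩

section Character

variable {Q : Type} [Group Q]

/-- The one-dimensional module of a linear character. -/
noncomputable abbrev charModule (χ : Q →* kˣ) : BModule k (MonoidAlgebra k Q) :=
  ofRep ((scalarUnits k k).comp χ)

lemma charModule_isSimple (χ : Q →* kˣ) :
    IsSimpleModule (MonoidAlgebra k Q) (charModule χ) := by
  have hn : Nontrivial (charModule χ) := inferInstanceAs (Nontrivial k)
  refine isSimpleModule_iff_toSpanSingleton_surjective.mpr ⟨hn, fun x hx y => ?_⟩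
  let a : k := x
  let c : k := y
  have ha : a ≠ 0 := hx
  refine ⟨algebraMap k _ (c / a), ?_⟩
  rw [LinearMap.toSpanSingleton_apply, algebraMap_smul]
  exact div_mul_cancel₀ c ha

lemma eq_of_charModule_equiv {χ χ' : Q →* kˣ}
    (h : Nonempty (charModule χ ≃ₗ[MonoidAlgebra k Q] charModule χ')) : χ = χ' := by
  obtain ⟨φ, hφ⟩ := nonempty_linearEquiv_iff.mp h
  have hn : Nontrivial (charModule χ) := inferInstanceAs (Nontrivial k)
  obtain ⟨v, hv⟩ := exists_ne (0 : charModule χ)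
  ext x
  have h1 := hφ x v
  rw [ofRep_smul, ofRep_smul] at h1
  have h2 : φ ((χ x : k) • v) = (χ' x : k) • φ v := h1
  rw [map_smul] at h2
  exact smul_left_injective k ((map_ne_zero_iff φ φ.injective).mpr hv) h2

lemma exists_charModule_equiv (hQ : BasicAlg k (MonoidAlgebra k Q))
    (V : BModule k (MonoidAlgebra k Q)) (hV : IsSimpleModule (MonoidAlgebra k Q) V) :
    ∃ χ : Q →* kˣ, Nonempty (V ≃ₗ[MonoidAlgebra k Q] charModule χ) := by
  obtain ⟨v, hv, hspan⟩ := hQ V hV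
  have hinj := smul_left_injective k hv
  choose c hc using fun x : Q => hspan (MonoidAlgebra.of k Q x • v)
  let γ : Q →* k :=
    { toFun := c
      map_one' := hinj (by
        dsimp only
        rw [← hc, map_one, one_smul, one_smul])
      map_mul' := fun x y => hinj (by
        dsimp only
        rw [← hc, map_mul, mul_smul, hc y, smul_algebra_smul_comm, hc x, smul_smul, mul_comm]) }
  refine ⟨γ.toHomUnits, nonempty_linearEquiv_iff.mpr ?_⟩
  let φ : charModule γ.toHomUnits ≃ₗ[k] V :=
    LinearEquiv.ofBijective (LinearMap.toSpanSingleton k V v)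
      ⟨hinj, fun w => by obtain ⟨d, rfl⟩ := hspan w; exact ⟨d, rfl⟩⟩
  have hφ : ∀ x u, φ (MonoidAlgebra.of k Q x • u) = MonoidAlgebra.of k Q x • φ u := by
    intro x u
    rw [ofRep_smul]
    let d : k := u
    change (c x * d) • v = MonoidAlgebra.of k Q x • d • v
    rw [smul_algebra_smul_comm, hc, smul_smul, mul_comm]
  refine ⟨φ.symm, fun x w => ?_⟩
  rw [LinearEquiv.symm_apply_eq, hφ, LinearEquiv.apply_symm_apply]

end Character

end Representations

section Counting

variable {k : Type} [Field k] {A L : Type} [Group A] [Group L]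

/-- The tensor product of a representation with a linear character of a quotient. -/
def charTwist {V : Type} [AddCommGroup V] [Module k V] {N : Subgroup L} [N.Normal]
    (χ : L ⧸ N →* kˣ) (ρ : L →* (Module.End k V)ˣ) : L →* (Module.End k V)ˣ where
  toFun x := scalarUnits k V (χ x) * ρ x
  map_one' := by rw [QuotientGroup.mk_one, map_one, map_one, map_one, one_mul]
  map_mul' x y := by
    rw [QuotientGroup.mk_mul, map_mul, map_mul, map_mul, mul_assoc, mul_assoc, ← mul_assoc (ρ x),
      ← scalarUnits_mul_comm, mul_assoc]

/-- The identification of the module of a representation with its underlying space. -/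
noncomputable def ofRepEquiv {V : Type} [AddCommGroup V] [Module k V]
    (ρ : L →* (Module.End k V)ˣ) : V ≃ₗ[k] ofRep ρ :=
  LinearEquiv.refl k V

lemma ofRepEquiv_apply {V : Type} [AddCommGroup V] [Module k V] (ρ : L →* (Module.End k V)ˣ)
    (x : L) (v : V) :
    ofRepEquiv ρ ((ρ x : Module.End k V) v) = MonoidAlgebra.of k L x • ofRepEquiv ρ v :=
  (ofRep_smul ρ x v).symm

variable {U : Type} [AddCommGroup U] [Module k U] [Module (MonoidAlgebra k A) U]
  [IsScalarTower k (MonoidAlgebra k A) U]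

lemma repOf_apply (a : A) (u : U) :
    (repOf k A U a : Module.End k U) u = MonoidAlgebra.of k A a • u :=
  rfl

variable {f : A →* L}

lemma extendsAlong_ofRep (ρ : L →* (Module.End k U)ˣ) (hρ : ∀ a, ρ (f a) = repOf k A U a) :
    ExtendsAlong k f U (ofRep ρ) :=
  (extendsAlong_iff f).mpr ⟨ofRepEquiv ρ, fun a u => by
    rw [← ofRepEquiv_apply, hρ, repOf_apply]⟩

/-- Every extension is given by a representation on the space of the module it extends. -/
lemma ExtendsAlong.exists_ofRep {W : BModule k (MonoidAlgebra k L)} (h : ExtendsAlong k f U W) :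
    ∃ ρ : L →* (Module.End k U)ˣ, (∀ a, ρ (f a) = repOf k A U a) ∧
      Nonempty (W ≃ₗ[MonoidAlgebra k L] ofRep ρ) := by
  obtain ⟨φ, hφ⟩ := (extendsAlong_iff f).mp h
  let c : (Module.End k W)ˣ →* (Module.End k U)ˣ :=
    Units.map (φ.symm.conjAlgEquiv k : Module.End k W →* Module.End k U)
  have hc : ∀ l u, ((c l : (Module.End k U)ˣ) : Module.End k U) u =
      φ.symm ((l : Module.End k W) (φ u)) := fun l u => rfl
  refine ⟨c.comp (repOf k L W), fun a => Units.ext (LinearMap.ext fun u => ?_), ?_⟩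
  · rw [MonoidHom.comp_apply, hc, repOf_apply, repOf_apply, ← hφ, φ.symm_apply_apply]
  · refine nonempty_linearEquiv_iff.mpr ⟨φ.symm.trans (ofRepEquiv _), fun x w => ?_⟩
    rw [LinearEquiv.trans_apply, LinearEquiv.trans_apply, ← ofRepEquiv_apply,
      MonoidHom.comp_apply, hc, repOf_apply, φ.apply_symm_apply]

/-- A stable brick of a normal subgroup has as many extensions as the quotient has simple
modules, provided that these are one-dimensional and that the second cohomology vanishes. -/
theorem repClasses_extendsAlong (hf : Function.Injective f) (N : Subgroup L) [N.Normal]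
    (hN : f.range = N) (hU : IsBrickOver k (MonoidAlgebra k A) U)
    (hst : ∀ x : L, ∃ ψ : U ≃ₗ[k] U, ∀ a a', f a' = x⁻¹ * f a * x →
      ∀ u, ψ (MonoidAlgebra.of k A a' • u) = MonoidAlgebra.of k A a • ψ u)
    (hH2 : H2Trivial k (L ⧸ N)) (hbasic : BasicAlg k (MonoidAlgebra k (L ⧸ N))) {e : ℕ}
    (he : RepClasses k (MonoidAlgebra k (L ⧸ N))
      (fun V => IsSimpleModule (MonoidAlgebra k (L ⧸ N)) V) e) :
    RepClasses k (MonoidAlgebra k L) (fun W => ExtendsAlong k f U W) e := by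
  subst hN
  have hUn := hU.1
  let E := MonoidHom.ofInjective hf
  let ρ : f.range →* (Module.End k U)ˣ := (repOf k A U).comp E.symm.toMonoidHom
  have hρ : ∀ a, ρ (E a) = repOf k A U a := fun a => congrArg (repOf k A U) (E.symm_apply_apply a)
  have hE : ∀ a, (E a : L) = f a := fun a => rfl
  have hC : ∀ l, (∀ h, l * ρ h = ρ h * l) → ∃ c, l = scalarUnits k U c := fun l hl =>
    hU.exists_eq_scalarUnits l fun a => by rw [← hρ, hl]
  have hiff : ∀ ρ' : L →* (Module.End k U)ˣ,
      (∀ h : f.range, ρ' h = ρ h) ↔ ∀ a, ρ' (f a) = repOf k A U a := fun ρ' =>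
    ⟨fun h a => by rw [← hρ, ← h, hE], fun h => E.surjective.forall.mpr fun a => by
      rw [hρ, hE, h]⟩
  obtain ⟨ρ₀, hρ₀⟩ := exists_extension_of_h2Trivial (ρ := ρ) scalarUnits_injective
    scalarUnits_mul_comm hC (fun x => by
      obtain ⟨ψ, hψ⟩ := hst x
      refine ⟨LinearMap.GeneralLinearGroup.ofLinearEquiv ψ, ?_⟩
      refine E.surjective.forall.mpr fun a => E.surjective.forall.mpr fun a' haa => ?_
      rw [hρ, hρ]
      exact Units.ext (LinearMap.ext fun u => hψ a a' haa u)) hH2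
  have htw : ∀ χ : L ⧸ f.range →* kˣ, ∀ a, charTwist χ ρ₀ (f a) = repOf k A U a := by
    intro χ a
    have h1 : ((f a : L) : L ⧸ f.range) = 1 :=
      (QuotientGroup.eq_one_iff _).mpr ⟨a, rfl⟩
    change scalarUnits k U (χ (f a : L)) * ρ₀ (f a) = _
    rw [h1, map_one, map_one, one_mul, (hiff ρ₀).mp hρ₀]
  have hinj : ∀ χ χ' : L ⧸ f.range →* kˣ, Nonempty (ofRep (charTwist χ ρ₀)
      ≃ₗ[MonoidAlgebra k L] ofRep (charTwist χ' ρ₀)) → χ = χ' := by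
    intro χ χ' h
    obtain ⟨φ, hφ⟩ := nonempty_linearEquiv_iff.mp h
    let ψ : U ≃ₗ[k] U := (ofRepEquiv _).trans (φ.trans (ofRepEquiv _).symm)
    have hψ : ∀ u, ofRepEquiv _ (ψ u) = φ (ofRepEquiv _ u) := fun u =>
      (ofRepEquiv _).apply_symm_apply _
    let l : (Module.End k U)ˣ := LinearMap.GeneralLinearGroup.ofLinearEquiv ψ
    have hl : ∀ x, l * charTwist χ ρ₀ x = charTwist χ' ρ₀ x * l := fun x =>
      Units.ext (LinearMap.ext fun u => (ofRepEquiv (charTwist χ' ρ₀)).injective <| by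
        change ofRepEquiv _ (ψ ((charTwist χ ρ₀ x : Module.End k U) u)) =
          ofRepEquiv _ ((charTwist χ' ρ₀ x : Module.End k U) (ψ u))
        rw [hψ, ofRepEquiv_apply, ofRepEquiv_apply, hφ, hψ])
    obtain ⟨c, hc⟩ := hU.exists_eq_scalarUnits l fun a => by
      rw [← htw χ, hl, htw, htw]
    refine MonoidHom.ext fun q => ?_
    obtain ⟨x, rfl⟩ := QuotientGroup.mk_surjective q
    have h1 := hl x
    rw [hc, scalarUnits_mul_comm] at h1
    exact scalarUnits_injective (mul_right_cancel (mul_right_cancel h1))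
  have hsurj : ∀ W : BModule k (MonoidAlgebra k L), ExtendsAlong k f U W →
      ∃ χ : L ⧸ f.range →* kˣ,
        Nonempty (W ≃ₗ[MonoidAlgebra k L] ofRep (charTwist χ ρ₀)) := by
    intro W hW
    obtain ⟨ρ₁, hρ₁, hWρ⟩ := hW.exists_ofRep
    obtain ⟨χ, hχ⟩ := exists_character_of_extensions scalarUnits_injective
      scalarUnits_mul_comm hC ρ₁ ρ₀ ((hiff ρ₁).mpr hρ₁) hρ₀
    obtain rfl : ρ₁ = charTwist χ ρ₀ := MonoidHom.ext hχ
    exact ⟨χ, hWρ⟩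
  obtain ⟨V, hV, hVne, hVall⟩ := he
  choose χ hχ using fun j => exists_charModule_equiv hbasic (V j) (hV j)
  refine ⟨fun j => ofRep (charTwist (χ j) ρ₀), fun j => extendsAlong_ofRep _ (htw _),
    fun i j hij => ⟨fun φ => ?_⟩, fun W hW => ?_⟩
  · obtain ⟨φi⟩ := hχ i
    obtain ⟨φj⟩ := hχ j
    rw [← hinj _ _ ⟨φ⟩] at φj
    exact (hVne i j hij).false (φi.trans φj.symm)
  · obtain ⟨χ', hχ'⟩ := hsurj W hW
    obtain ⟨j, ⟨φ⟩⟩ := hVall (charModule χ') (charModule_isSimple χ')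
    obtain ⟨φj⟩ := hχ j
    obtain rfl := eq_of_charModule_equiv ⟨φ.trans φj⟩
    exact ⟨j, hχ'⟩

end Counting

section Conjugation

variable (k : Type) [Field k] {Gt : Type} [Group Gt] (G : Subgroup Gt) [G.Normal]

lemma mapAlong_conjHom_cancel {x y : Gt} (h : x * y = 1) (a : MonoidAlgebra k G) :
    MapAlong k (conjHom Gt G x) (MapAlong k (conjHom Gt G y) a) = a := by
  have hyx : y = x⁻¹ := eq_inv_of_mul_eq_one_right h
  subst hyx
  induction a using MonoidAlgebra.induction_on with
  | of g =>
    rw [mapAlong_of, mapAlong_of]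
    congr 1
    apply Subtype.ext
    change x⁻¹ * (x⁻¹⁻¹ * (g : Gt) * x⁻¹) * x = g
    group
  | add r s hr hs => rw [map_add, map_add, hr, hs]
  | smul c r hr =>
    rw [Algebra.smul_def, map_mul, map_mul, hr, mapAlong_algebraMap, mapAlong_algebraMap]

/-- The automorphism of the group algebra of a normal subgroup given by conjugation. -/
noncomputable def conjEquiv (x : Gt) : MonoidAlgebra k G ≃+* MonoidAlgebra k G :=
  RingEquiv.ofRingHom (MapAlong k (conjHom Gt G x)) (MapAlong k (conjHom Gt G x⁻¹))
    (RingHom.ext fun a => mapAlong_conjHom_cancel k G (mul_inv_cancel x) a)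
    (RingHom.ext fun a => mapAlong_conjHom_cancel k G (inv_mul_cancel x) a)

variable {k G}

lemma of_mul_mapAlong_conjHom (x : Gt) (a : MonoidAlgebra k G) :
    MonoidAlgebra.of k Gt x * MapAlong k G.subtype (MapAlong k (conjHom Gt G x) a) =
      MapAlong k G.subtype a * MonoidAlgebra.of k Gt x := by
  induction a using MonoidAlgebra.induction_on with
  | of g =>
    rw [mapAlong_of, mapAlong_of, mapAlong_of, ← map_mul, ← map_mul]
    congr 1
    change x * (x⁻¹ * (g : Gt) * x) = g * x
    group
  | add r s hr hs => rw [map_add, map_add, map_add, mul_add, hr, hs, add_mul]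
  | smul c r hr =>
    rw [Algebra.smul_def, map_mul, map_mul, map_mul, mapAlong_algebraMap, mapAlong_algebraMap,
      mul_assoc, ← hr, ← mul_assoc, ← mul_assoc, Algebra.commutes]

lemma mapAlong_conjHom_eq_of_mem_inertia {b : MonoidAlgebra k G} {x : Gt}
    (hx : x ∈ inertia k Gt G b) : MapAlong k (conjHom Gt G x) b = b := by
  refine (MonoidAlgebra.mapDomain_injective (R := k) G.subtype_injective :
    Function.Injective (MapAlong k G.subtype)) ?_
  have hc : MonoidAlgebra.of k Gt x * MapAlong k G.subtype b =
    MapAlong k G.subtype b * MonoidAlgebra.of k Gt x := hx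
  rw [← of_mul_mapAlong_conjHom] at hc
  have hu : MonoidAlgebra.of k Gt x⁻¹ * MonoidAlgebra.of k Gt x = 1 := by
    rw [← map_mul, inv_mul_cancel, map_one]
  have := congrArg (MonoidAlgebra.of k Gt x⁻¹ * ·) hc
  simp only [← mul_assoc, hu, one_mul] at this
  exact this.symm

variable {U : Type} [AddCommGroup U] [Module (MonoidAlgebra k G) U]

lemma IsStableAt.nonempty_twist_equiv {x : Gt} (h : IsStableAt k Gt G x U)
    (σ : MonoidAlgebra k G ≃+* MonoidAlgebra k G)
    (hσ : ∀ a, σ a = MapAlong k (conjHom Gt G x) a) :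
    Nonempty (Twist σ U ≃ₗ[MonoidAlgebra k G] U) := by
  obtain ⟨ψ, hψ⟩ := h
  exact ⟨{ (Twist.out σ).trans ψ with
    map_smul' := fun a u => by
      change ψ (Twist.out σ (a • u)) = a • ψ (Twist.out σ u)
      rw [Twist.out_smul, hσ, hψ] }⟩

lemma isStableAt_of_twist_equiv {x : Gt}
    (h : Nonempty (Twist (conjEquiv k G x) U ≃ₗ[MonoidAlgebra k G] U)) :
    IsStableAt k Gt G x U := by
  obtain ⟨φ⟩ := h
  refine ⟨(Twist.out (conjEquiv k G x)).symm.trans φ.toAddEquiv, fun a u => ?_⟩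
  exact (congrArg φ (Twist.symm_smul (conjEquiv k G x) a u)).trans (map_smul φ _ _)

/-- Stability in terms of the action of the group elements. -/
lemma IsStableAt.exists_linearEquiv [Module k U] [IsScalarTower k (MonoidAlgebra k G) U]
    {x : Gt} (h : IsStableAt k Gt G x U) :
    ∃ ψ : U ≃ₗ[k] U, ∀ g u, ψ (MonoidAlgebra.of k G (conjHom Gt G x g) • u) =
      MonoidAlgebra.of k G g • ψ u := by
  obtain ⟨ψ, hψ⟩ := h
  refine ⟨{ ψ with map_smul' := fun c u => ?_ }, fun g u => ?_⟩
  · change ψ (c • u) = c • ψ u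
    rw [← algebraMap_smul (MonoidAlgebra k G) c u, ← mapAlong_algebraMap k (conjHom Gt G x), hψ,
      algebraMap_smul]
  · change ψ _ = _ • ψ u
    rw [← hψ, mapAlong_of]

end Conjugation

/-- Schur's lemma for the bricks of a semibrick. -/
lemma eq_zero_or_bijective_of_isBrickOver {k R : Type} [Field k] [Ring R] [Algebra k R] {U V : Type}
    [AddCommGroup U] [Module R U] [AddCommGroup V] [Module R V] (hU : IsBrickOver k R U)
    (h : IsEmpty (U ≃ₗ[R] V) → ∀ f : U →ₗ[R] V, f = 0) (f : U →ₗ[R] V) :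
    f = 0 ∨ Function.Bijective f := by
  rcases isEmpty_or_nonempty (U ≃ₗ[R] V) with hne | ⟨⟨φ⟩⟩
  · exact Or.inl (h hne f)
  obtain ⟨c, hc⟩ := hU.2 (φ.symm.toLinearMap.comp f)
  have hf : ∀ u, f u = algebraMap k R c • φ u := fun u => by
    rw [← map_smul, ← hc]
    exact (φ.apply_symm_apply _).symm
  by_cases hc0 : c = 0
  · refine Or.inl (LinearMap.ext fun u => ?_)
    rw [hf, hc0, map_zero, zero_smul, LinearMap.zero_apply]
  · have hu : IsUnit (algebraMap k R c) := (IsUnit.mk0 c hc0).map _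
    have : (f : U → V) = (fun v => algebraMap k R c • v) ∘ φ := funext hf
    rw [this]
    exact Or.inr ((MulAction.bijective hu.unit).comp φ.bijective)

/-- Under conditions (i)–(iii) on the block `B` of `kG` and its
inertia group `I`, every indecomposable summand `Sᵢ` of a left finite semibrick in
`B`-mod has exactly `e` isomorphism classes of extending `kI`-modules, all of which
are bricks. -/
theorem statement_14 (k : Type) [Field k] [IsAlgClosed k]
    (p : ℕ) [Fact p.Prime] [CharP k p]
    (Gt : Type) [Group Gt] [Finite Gt] (G : Subgroup Gt) [G.Normal]
    (b : MonoidAlgebra k ↥G) (hb : IsBlockIdem (MonoidAlgebra k ↥G) b)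
    (hGI : G ≤ inertia k Gt G b)
    (hstable : ∀ S : BModule k (MonoidAlgebra k ↥G),
        Module.Finite (MonoidAlgebra k ↥G) ↥S → LiesIn (MonoidAlgebra k ↥G) b ↥S →
        IsBrickOver k (MonoidAlgebra k ↥G) ↥S →
        IsLeftFiniteIn (MonoidAlgebra k ↥G) (BlockFG (MonoidAlgebra k ↥G) b) ↥S →
        ∀ x ∈ inertia k Gt G b, IsStableAt k Gt G x ↥S)
    (hH2 : H2Trivial k (↥(inertia k Gt G b) ⧸ G.subgroupOf (inertia k Gt G b)))
    (hbasic : BasicAlg k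
      (MonoidAlgebra k (↥(inertia k Gt G b) ⧸ G.subgroupOf (inertia k Gt G b))))
    (e : ℕ)
    (he : RepClasses k
        (MonoidAlgebra k (↥(inertia k Gt G b) ⧸ G.subgroupOf (inertia k Gt G b)))
        (fun V => IsSimpleModule
          (MonoidAlgebra k (↥(inertia k Gt G b) ⧸ G.subgroupOf (inertia k Gt G b)))
          ↥V) e)
    (n : ℕ) (S : Fin n → BModule k (MonoidAlgebra k ↥G))
    (hfg : ∀ i, Module.Finite (MonoidAlgebra k ↥G) ↥(S i))
    (hblock : ∀ i, LiesIn (MonoidAlgebra k ↥G) b ↥(S i))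
    (hbricks : ∀ i, IsBrickOver k (MonoidAlgebra k ↥G) ↥(S i))
    (hhom : ∀ i j, IsEmpty (↥(S i) ≃ₗ[MonoidAlgebra k ↥G] ↥(S j)) →
        ∀ f : ↥(S i) →ₗ[MonoidAlgebra k ↥G] ↥(S j), f = 0)
    (hLF : IsLeftFiniteIn (MonoidAlgebra k ↥G) (BlockFG (MonoidAlgebra k ↥G) b)
        ((i : Fin n) → ↥(S i)))
    (i : Fin n) :
    RepClasses k (MonoidAlgebra k ↥(inertia k Gt G b))
      (fun W => ExtendsAlong k (Subgroup.inclusion hGI) ↥(S i) ↥W) e ∧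
    ∀ W : BModule k (MonoidAlgebra k ↥(inertia k Gt G b)),
      ExtendsAlong k (Subgroup.inclusion hGI) ↥(S i) ↥W →
      IsBrickOver k (MonoidAlgebra k ↥(inertia k Gt G b)) ↥W := by
  have hfin : Module.Finite k (MonoidAlgebra k G) := inferInstance
  have hn : ∀ j, Nontrivial (S j) := fun j => (hbricks j).1
  have hst : ∀ x ∈ inertia k Gt G b, IsStableAt k Gt G x (S i) := by
    intro x hx
    refine isStableAt_of_twist_equiv (nonempty_twist_equiv_of_semibrick (k := k) hb.2.1
      (mapAlong_algebraMap k (conjHom Gt G x)) (mapAlong_conjHom_eq_of_mem_inertia hx)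
      (fun U hU hUb hUbr hULF => ⟨?_, ?_⟩) S hblock
      (fun i j => eq_zero_or_bijective_of_isBrickOver (hbricks i) (hhom i j)) hLF i)
    · exact (hstable U hU hUb hUbr hULF x hx).nonempty_twist_equiv _ fun a => rfl
    · exact (hstable U hU hUb hUbr hULF x⁻¹ (inv_mem hx)).nonempty_twist_equiv _ fun a => rfl
  refine ⟨repClasses_extendsAlong (Subgroup.inclusion_injective hGI) _
    (Subgroup.inclusion_range hGI) (hbricks i) (fun x => ?_) hH2 hbasic he,
    fun W hW => hW.isBrickOver (hbricks i)⟩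
  obtain ⟨ψ, hψ⟩ := (hst x x.2).exists_linearEquiv
  refine ⟨ψ, fun a a' h u => ?_⟩
  have h' : (a' : Gt) = (x : Gt)⁻¹ * a * x := congrArg Subtype.val h
  obtain rfl : a' = conjHom Gt G x a := Subtype.ext h'
  exact hψ a u

end Paper
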